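/- arXiv:0909.2809 — 5 statements merged into one kernel-verified Lean document; each statement's English description precedes it below -/
import Mathlib

section
/- For every symplectic form θ on ℝ^{2n} (i.e., a nondegenerate alternating bilinear form) there exists a linear complex structure J ∈ End(ℝ^{2n}) with J² = −id such that the bilinear form g(u,v) = θ(u, Jv) is symmetric and positive definite. -/
/-- Every nondegenerate alternating form on a finite-dimensional real vector space admits a
compatible complex structure. The proof splits off a hyperbolic plane and inducts on dimension. -/
theorem LinearMap.IsAlt.exists_compatible_complexStructure {V : Type*} [AddCommGroup V]
    [Module ℝ V] [FiniteDimensional ℝ V] {θ : V →ₗ[ℝ] V →ₗ[ℝ] ℝ} (halt : θ.IsAlt)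
    (hnd : θ.SeparatingLeft) :
    ∃ J : V →ₗ[ℝ] V,
      (∀ u, J (J u) = -u) ∧
      (∀ u v, θ u (J v) = θ v (J u)) ∧
      (∀ u, u ≠ 0 → 0 < θ u (J u)) := by
  induction hd : Module.finrank ℝ V using Nat.strong_induction_on generalizing V with
  | _ d ih =>
    subst hd
    rcases subsingleton_or_nontrivial V with hV | hV
    · exact ⟨0, fun u => Subsingleton.elim _ _, fun u v => by simp,
        fun u hu => (hu (Subsingleton.elim _ _)).elim⟩
    obtain ⟨e, he⟩ := exists_ne (0 : V)
    obtain ⟨f, hef⟩ : ∃ f, θ e f = 1 := by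
      obtain ⟨v, hv⟩ := not_forall.mp (mt (hnd e) he)
      exact ⟨(θ e v)⁻¹ • v, by simp [hv]⟩
    have hfe : θ f e = -1 := by rw [← halt.neg, hef]
    have hee : θ e e = 0 := halt e
    have hff : θ f f = 0 := halt f
    let W : Submodule ℝ V := LinearMap.ker (θ.flip e) ⊓ LinearMap.ker (θ.flip f)
    have hWe (w : W) : θ (w : V) e = 0 := w.2.1
    have hWf (w : W) : θ (w : V) f = 0 := w.2.2
    have hW_lt : Module.finrank ℝ W < Module.finrank ℝ V := by
      refine Submodule.finrank_lt fun hW => ?_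
      have h := hWf ⟨e, hW ▸ Submodule.mem_top⟩
      simp [hef] at h
    let P : V →ₗ[ℝ] W :=
      (LinearMap.id - (θ.flip f).smulRight e + (θ.flip e).smulRight f).codRestrict W fun u => by
        constructor <;> simp [hee, hef, hfe, hff]
    have hP (u : V) : (P u : V) = u - θ u f • e + θ u e • f := rfl
    have hPW (w : W) : P w = w := by
      ext; simp [hP, hWe, hWf]
    have hPe : P e = 0 := by
      ext; simp [hP, hee, hef]
    have hPf : P f = 0 := by
      ext; simp [hP, hff, hfe]
    have hθP (u : V) (w : W) : θ u w = θ (P u : V) w := by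
      have h₁ : θ e w = 0 := by rw [← halt.neg, hWe, neg_zero]
      have h₂ : θ f w = 0 := by rw [← halt.neg, hWf, neg_zero]
      simp [hP, h₁, h₂]
    have hW_nd : (θ.domRestrict₁₂ W W).SeparatingLeft := by
      intro w hw
      refine Subtype.ext (hnd w fun v => ?_)
      rw [← halt.neg, hθP, halt.neg]
      exact hw (P v)
    obtain ⟨K, hK_sq, hK_symm, hK_pos⟩ :=
      ih _ hW_lt (θ := θ.domRestrict₁₂ W W) (fun w => halt w) hW_nd rfl
    simp only [LinearMap.domRestrict₁₂_apply] at hK_symm hK_pos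
    let J : V →ₗ[ℝ] V :=
      W.subtype ∘ₗ K ∘ₗ P + (θ.flip f).smulRight f + (θ.flip e).smulRight e
    have hJ (u : V) : J u = K (P u) + θ u f • f + θ u e • e := rfl
    have hθJ (u v : V) :
        θ u (J v) = θ (P u : V) (K (P v)) + θ v f * θ u f + θ v e * θ u e := by
      simp [hJ, hθP u]
    refine ⟨J, fun u => ?_, fun u v => ?_, fun u hu => ?_⟩
    · have h₁ : P (J u) = K (P u) := by simp [hJ, hPW, hPe, hPf]
      have h₂ : θ (J u) f = θ u e := by simp [hJ, hWf, hff, hef]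
      have h₃ : θ (J u) e = -θ u f := by simp [hJ, hWe, hee, hfe]
      rw [hJ (J u), h₁, h₂, h₃, hK_sq, Submodule.coe_neg, hP]
      module
    · rw [hθJ, hθJ, hK_symm]
      ring
    · rw [hθJ]
      by_cases hPu : P u = 0
      · have hu_eq : u = θ u f • e - θ u e • f := by
          have h := hP u
          rw [hPu, Submodule.coe_zero] at h
          linear_combination (norm := module) -h
        have hne : θ u f ≠ 0 ∨ θ u e ≠ 0 := by
          by_contra! h
          exact hu (by rw [hu_eq, h.1, h.2]; simp)
        simp only [hPu, map_zero, Submodule.coe_zero, zero_add]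
        rcases hne with h | h
        · have := mul_self_pos.mpr h
          have := mul_self_nonneg (θ u e)
          linarith
        · have := mul_self_pos.mpr h
          have := mul_self_nonneg (θ u f)
          linarith
      · have := hK_pos _ hPu
        have := mul_self_nonneg (θ u e)
        have := mul_self_nonneg (θ u f)
        linarith


theorem exists_compatible_complex_structure {n : ℕ}
    -- `θ` is a bilinear form on `ℝ^{2n}` ...
    (θ : (Fin (2*n) → ℝ) →ₗ[ℝ] (Fin (2*n) → ℝ) →ₗ[ℝ] ℝ)
    -- ... which is alternating ...
    (halt : ∀ u, θ u u = 0)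
    -- ... and nondegenerate:
    (hnd : ∀ u, (∀ v, θ u v = 0) → u = 0) :
    -- then there is a linear complex structure `J` (`J² = -id`) such that
    -- `g(u,v) = θ(u, Jv)` is symmetric and positive definite:
    ∃ J : (Fin (2*n) → ℝ) →ₗ[ℝ] (Fin (2*n) → ℝ),
      (∀ u, J (J u) = -u) ∧
      (∀ u v, θ u (J v) = θ v (J u)) ∧
      (∀ u, u ≠ 0 → 0 < θ u (J u)) := by
  exact LinearMap.IsAlt.exists_compatible_complexStructure halt hnd
end

section
/- S_ℏ smooths: for every ℏ > 0 and every a ∈ A, the element S_ℏ(a) is a smooth vector of the action, i.e., the map v ↦ α_v(S_ℏ(a)) from ℝ^{2n} to A is infinitely Fréchet-differentiable. -/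
open MeasureTheory Filter

/-- The standard symplectic form `θ` on `ℝ^{2n}`:
`θ(u,v) = Σ_{k=1}^n (u_k v_{n+k} - u_{n+k} v_k)`. -/
noncomputable def stdSymp (n : ℕ) (u v : Fin (2*n) → ℝ) : ℝ :=
  ∑ k : Fin n,
    (u ⟨k.1, by omega⟩ * v ⟨n + k.1, by omega⟩ - u ⟨n + k.1, by omega⟩ * v ⟨k.1, by omega⟩)

/-- Rieffel's Gaussian smoothing operator
`S_ℏ(a) = (πℏ)^{-n} ∫_{ℝ^{2n}} e^{-g(u,u)/ℏ} α_u(a) du` (a Bochner integral w.r.t. Lebesgue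
measure). -/
noncomputable def smoothingOp {n : ℕ} {A : Type*} [NonUnitalCStarAlgebra A]
    (α : (Fin (2*n) → ℝ) → (A ≃⋆ₐ[ℂ] A)) (g : (Fin (2*n) → ℝ) → (Fin (2*n) → ℝ) → ℝ)
    (ℏ : ℝ) (a : A) : A :=
  ((Real.pi * ℏ) ^ n)⁻¹ • ∫ u : Fin (2*n) → ℝ, Real.exp (-(g u u) / ℏ) • α u a

universe u v

open Real in
theorem integrable_exp_mul_norm_smulRight {X : Type*} [MeasurableSpace X] {μ : Measure X}
    {E : Type*} [NormedAddCommGroup E] [NormedSpace ℝ E]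
    {W : Type*} [NormedAddCommGroup W] [NormedSpace ℝ W]
    {ℓ : X → E →L[ℝ] ℝ} {K : X → W}
    (hℓ : AEStronglyMeasurable ℓ μ) (hK : AEStronglyMeasurable K μ)
    (hint : ∀ c : ℝ, Integrable (fun x => exp (c * ‖ℓ x‖) * ‖K x‖) μ) (c : ℝ) :
    Integrable (fun x => exp (c * ‖ℓ x‖) * ‖(ℓ x).smulRight (K x)‖) μ := by
  simp only [ContinuousLinearMap.norm_smulRight_apply]
  refine (hint (c + 1)).mono'
    ((continuous_exp.comp_aestronglyMeasurable (hℓ.norm.const_mul c)).mul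
      (hℓ.norm.mul hK.norm)) (.of_forall fun x => ?_)
  rw [norm_of_nonneg (by positivity), add_mul, one_mul, exp_add, mul_assoc]
  gcongr
  linarith [add_one_le_exp ‖ℓ x‖]

open Real in
/-- A parametric integral of exponentials of linear functionals against a weight with finite
exponential moments may be differentiated under the integral sign. -/
theorem hasFDerivAt_integral_exp_smul {X : Type*} [MeasurableSpace X] {μ : Measure X}
    {E : Type*} [NormedAddCommGroup E] [NormedSpace ℝ E]
    {W : Type*} [NormedAddCommGroup W] [NormedSpace ℝ W]
    {ℓ : X → E →L[ℝ] ℝ} {K : X → W}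
    (hℓ : AEStronglyMeasurable ℓ μ) (hK : AEStronglyMeasurable K μ)
    (hint : ∀ c : ℝ, Integrable (fun x => exp (c * ‖ℓ x‖) * ‖K x‖) μ)
    (v₀ : E) :
    HasFDerivAt (fun v : E => ∫ x, exp (ℓ x v) • K x ∂μ)
      (∫ x, exp (ℓ x v₀) • (ℓ x).smulRight (K x) ∂μ) v₀ := by
  have hexp : ∀ v : E, AEStronglyMeasurable (fun x => exp (ℓ x v)) μ := fun v =>
    continuous_exp.comp_aestronglyMeasurable (hℓ.apply_continuousLinearMap v)
  have hle : ∀ (x : X) (v : E) (c : ℝ), ‖v‖ ≤ c → ‖exp (ℓ x v)‖ ≤ exp (c * ‖ℓ x‖) := by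
    intro x v c hv
    rw [norm_of_nonneg (exp_pos _).le, exp_le_exp]
    calc ℓ x v ≤ ‖ℓ x v‖ := le_norm_self _
      _ ≤ ‖ℓ x‖ * ‖v‖ := (ℓ x).le_opNorm v
      _ ≤ c * ‖ℓ x‖ := by rw [mul_comm]; gcongr
  refine hasFDerivAt_integral_of_dominated_of_fderiv_le (𝕜 := ℝ)
    (F := fun v x => exp (ℓ x v) • K x) (F' := fun v x => exp (ℓ x v) • (ℓ x).smulRight (K x))
    (Metric.ball_mem_nhds v₀ one_pos)
    (.of_forall fun v => (hexp v).smul hK) ?_ ?_ (.of_forall fun x v hv => ?_)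
    (integrable_exp_mul_norm_smulRight hℓ hK hint (‖v₀‖ + 1)) (.of_forall fun x v _ => ?_)
  · refine (hint ‖v₀‖).mono' ((hexp v₀).smul hK) (.of_forall fun x => ?_)
    rw [norm_smul]
    gcongr
    exact hle x v₀ _ le_rfl
  · exact (hexp v₀).smul
      ((ContinuousLinearMap.smulRightL ℝ E W).aestronglyMeasurable_comp₂ hℓ hK)
  · rw [norm_smul]
    gcongr
    refine hle x v _ ?_
    have := norm_sub_norm_le v v₀
    have := mem_ball_iff_norm.1 hv
    linarith
  · convert ((ℓ x).hasFDerivAt (x := v)).exp.smul_const (K x) using 1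
    ext w
    simp [smul_smul]

open Real in
/-- A parametric integral of exponentials of linear functionals against a weight with finite
exponential moments is smooth. -/
theorem contDiff_integral_exp_smul {X : Type*} [MeasurableSpace X] {μ : Measure X}
    {E : Type u} [NormedAddCommGroup E] [NormedSpace ℝ E]
    {W : Type (max u v)} [NormedAddCommGroup W] [NormedSpace ℝ W]
    {ℓ : X → E →L[ℝ] ℝ} {K : X → W}
    (hℓ : AEStronglyMeasurable ℓ μ) (hK : AEStronglyMeasurable K μ)
    (hint : ∀ c : ℝ, Integrable (fun x => exp (c * ‖ℓ x‖) * ‖K x‖) μ) :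
    ContDiff ℝ (⊤ : ℕ∞) fun v : E => ∫ x, exp (ℓ x v) • K x ∂μ := by
  refine contDiff_infty.2 fun k => ?_
  induction k generalizing W with
  | zero =>
    exact contDiff_zero.2 (continuous_iff_continuousAt.2 fun v =>
      (hasFDerivAt_integral_exp_smul hℓ hK hint v).continuousAt)
  | succ k ih =>
    exact contDiff_succ_iff_hasFDerivAt.2 ⟨_,
      ih ((ContinuousLinearMap.smulRightL ℝ E W).aestronglyMeasurable_comp₂ hℓ hK)
        (integrable_exp_mul_norm_smulRight hℓ hK hint),
      hasFDerivAt_integral_exp_smul hℓ hK hint⟩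

open Real in
theorem integrable_exp_neg_norm {E : Type*} [NormedAddCommGroup E] [NormedSpace ℝ E]
    [FiniteDimensional ℝ E] [MeasurableSpace E] [BorelSpace E] (μ : Measure E)
    [μ.IsAddHaarMeasure] : Integrable (fun x : E => exp (-‖x‖)) μ := by
  set N := Module.finrank ℝ E + 1 with hN
  have h := (integrable_one_add_norm (E := E) (μ := μ) (r := (N : ℝ))
    (by rw [hN]; push_cast; linarith)).const_mul (exp 1 * N.factorial)
  refine h.mono' (by fun_prop) (.of_forall fun x => ?_)
  have hx := norm_nonneg x
  have h1 := Real.pow_div_factorial_le_exp (1 + ‖x‖) (by positivity) N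
  rw [norm_of_nonneg (exp_pos _).le, rpow_neg (by positivity), rpow_natCast, ← div_eq_mul_inv,
    le_div_iff₀ (by positivity), exp_neg, inv_mul_le_iff₀ (exp_pos _)]
  rw [div_le_iff₀ (by positivity), exp_add] at h1
  linarith

/-- A positive-definite bilinear form on a finite-dimensional space dominates a multiple of the
squared norm. -/
theorem exists_pos_mul_sq_norm_le {E : Type*} [NormedAddCommGroup E] [NormedSpace ℝ E]
    [FiniteDimensional ℝ E] (B : E →L[ℝ] E →L[ℝ] ℝ) (hB : ∀ u, u ≠ 0 → 0 < B u u) :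
    ∃ m > 0, ∀ u, m * ‖u‖ ^ 2 ≤ B u u := by
  rcases (Metric.sphere (0 : E) 1).eq_empty_or_nonempty with h | h
  · refine ⟨1, one_pos, fun u => ?_⟩
    by_cases hu : u = 0
    · simp [hu]
    · have : ‖u‖⁻¹ • u ∈ Metric.sphere (0 : E) 1 := by
        simp [norm_smul, inv_mul_cancel₀ (norm_ne_zero_iff.2 hu)]
      simp [h] at this
  · have : ProperSpace E := FiniteDimensional.proper ℝ E
    obtain ⟨w, hw, hmin⟩ := (isCompact_sphere (0 : E) 1).exists_isMinOn h
      (f := fun u => B u u) (by fun_prop)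
    have hw0 : w ≠ 0 := by
      rintro rfl
      simp at hw
    refine ⟨B w w, hB w hw0, fun u => ?_⟩
    by_cases hu : u = 0
    · simp [hu]
    · have hu' := norm_pos_iff.2 hu
      have hmem : ‖u‖⁻¹ • u ∈ Metric.sphere (0 : E) 1 := by
        simp [norm_smul, inv_mul_cancel₀ hu'.ne']
      have hle : B w w ≤ B (‖u‖⁻¹ • u) (‖u‖⁻¹ • u) := hmin hmem
      have hsc : B (‖u‖⁻¹ • u) (‖u‖⁻¹ • u) = B u u / ‖u‖ ^ 2 := by
        simp only [map_smul, smul_apply, smul_eq_mul]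
        field_simp
      rwa [hsc, le_div_iff₀ (by positivity)] at hle

open Real in
/-- A Gaussian weight has finite exponential moments of every order. -/
theorem integrable_exp_mul_norm_mul_gaussian {E : Type*} [NormedAddCommGroup E] [NormedSpace ℝ E]
    [FiniteDimensional ℝ E] [MeasurableSpace E] [BorelSpace E] (μ : Measure E)
    [μ.IsAddHaarMeasure] (B : E →L[ℝ] E →L[ℝ] ℝ) (hB : ∀ u, u ≠ 0 → 0 < B u u) {r : ℝ}
    (hr : 0 < r) (c : ℝ) : Integrable (fun u => exp (c * ‖u‖) * exp (-B u u / r)) μ := by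
  obtain ⟨m, hm, hmB⟩ := exists_pos_mul_sq_norm_le B hB
  refine ((integrable_exp_neg_norm μ).const_mul (exp ((c + 1) ^ 2 * r / (4 * m)))).mono'
    (Continuous.aestronglyMeasurable (by fun_prop)) (.of_forall fun u => ?_)
  rw [norm_of_nonneg (by positivity), ← exp_add, ← exp_add, exp_le_exp]
  have h1 : m * ‖u‖ ^ 2 / r ≤ B u u / r := by gcongr; exact hmB u
  have h2 : 0 ≤ m / r * (‖u‖ - (c + 1) * r / (2 * m)) ^ 2 := by positivity
  have h3 : m / r * (‖u‖ - (c + 1) * r / (2 * m)) ^ 2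
      = m * ‖u‖ ^ 2 / r - (c + 1) * ‖u‖ + (c + 1) ^ 2 * r / (4 * m) := by
    field_simp
    ring
  rw [neg_div]
  linarith

theorem isBilinearMap_stdSymp_comp {n : ℕ}
    (J : (Fin (2*n) → ℝ) →ₗ[ℝ] (Fin (2*n) → ℝ)) :
    IsBilinearMap ℝ fun u v => stdSymp n u (J v) where
  add_left u u' v := by
    simp only [stdSymp, Pi.add_apply, ← Finset.sum_add_distrib]
    exact Finset.sum_congr rfl fun _ _ => by ring
  smul_left c u v := by
    simp only [stdSymp, Pi.smul_apply, smul_eq_mul, Finset.mul_sum]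
    exact Finset.sum_congr rfl fun _ _ => by ring
  add_right u v v' := by
    simp only [stdSymp, map_add, Pi.add_apply, ← Finset.sum_add_distrib]
    exact Finset.sum_congr rfl fun _ _ => by ring
  smul_right c u v := by
    simp only [stdSymp, map_smul, Pi.smul_apply, smul_eq_mul, Finset.mul_sum]
    exact Finset.sum_congr rfl fun _ _ => by ring

theorem smoothingOp_smooths {n : ℕ} {A : Type*} [NonUnitalCStarAlgebra A]
    -- `α` is an action of `(ℝ^{2n}, +)` by *-automorphisms ...
    (α : (Fin (2*n) → ℝ) → (A ≃⋆ₐ[ℂ] A))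
    (hhom : ∀ u v : Fin (2*n) → ℝ, ∀ a : A, α (u + v) a = α u (α v a))
    -- ... which is strongly continuous:
    (hcont : ∀ a : A, Continuous fun u => α u a)
    -- `J` is a linear complex structure on `ℝ^{2n}` ...
    (J : (Fin (2*n) → ℝ) →ₗ[ℝ] (Fin (2*n) → ℝ))
    (hJ : ∀ u, J (J u) = -u)
    -- ... compatible with the standard symplectic form `θ`, i.e. `g(u,v) = θ(u, Jv)` is a
    -- symmetric positive-definite inner product:
    (g : (Fin (2*n) → ℝ) → (Fin (2*n) → ℝ) → ℝ)
    (hg : ∀ u v, g u v = stdSymp n u (J v))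
    (hgsymm : ∀ u v, g u v = g v u)
    (hgpos : ∀ u, u ≠ 0 → 0 < g u u) :
    -- `S_ℏ(a)` is a smooth vector of the action:
    ∀ ℏ : ℝ, 0 < ℏ → ∀ a : A,
      ContDiff ℝ (⊤ : ℕ∞) fun v : Fin (2*n) → ℝ => α v (smoothingOp α g ℏ a) := by
  intro ℏ hℏ a
  obtain ⟨B, hB⟩ : ∃ B : (Fin (2*n) → ℝ) →L[ℝ] (Fin (2*n) → ℝ) →L[ℝ] ℝ, ∀ u v, B u v = g u v :=
    ⟨(isBilinearMap_stdSymp_comp J).toContinuousBilinearMap, fun u v => by simp [hg]⟩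
  have hBpos : ∀ u, u ≠ 0 → 0 < B u u := fun u hu => by simpa [hB] using hgpos u hu
  have hnorm : ∀ u b, ‖α u b‖ = ‖b‖ := fun u b =>
    NonUnitalStarAlgHom.norm_map (α u) (EquivLike.injective (α u)) b
  have hαℝ : ∀ (u) (r : ℝ) (b : A), α u (r • b) = r • α u b := fun u r b => by
    rw [← Complex.coe_smul, map_smul, Complex.coe_smul]
  have hα : ∀ v, ∃ L : A →ₗᵢ[ℝ] A, ∀ b, L b = α v b := fun v =>
    ⟨{ toFun := α v, map_add' := map_add (α v), map_smul' := hαℝ v, norm_map' := hnorm v },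
      fun _ => rfl⟩
  have key : ∀ v, α v (smoothingOp α g ℏ a) =
      ((Real.pi * ℏ) ^ n)⁻¹ • Real.exp (-B v v / ℏ) •
        ∫ u, Real.exp (((2 / ℏ) • B u) v) • Real.exp (-B u u / ℏ) • α u a := by
    intro v
    obtain ⟨L, hL⟩ := hα v
    have hshift := integral_add_right_eq_self (μ := volume)
      (fun w => Real.exp (-B (w - v) (w - v) / ℏ) • α w a) v
    rw [smoothingOp, ← hL, map_smul, ← L.integral_comp_comm]
    congr 1
    rw [← integral_smul]
    calc ∫ u, L (Real.exp (-(g u u) / ℏ) • α u a)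
        = ∫ u, Real.exp (-B (u + v - v) (u + v - v) / ℏ) • α (u + v) a := by
          refine integral_congr_ae (.of_forall fun u => ?_)
          simp only [hL, hαℝ, hB, add_comm u v, add_sub_cancel_left, hhom]
      _ = _ := hshift
      _ = _ := by
          refine integral_congr_ae (.of_forall fun u => ?_)
          simp only [smul_smul, ← Real.exp_add]
          congr 2
          simp only [map_sub, sub_apply, smul_apply, smul_eq_mul, hB,
            hgsymm v u]
          ring
  have hexp : ContDiff ℝ (⊤ : ℕ∞) fun v => Real.exp (-B v v / ℏ) := by fun_prop
  simp_rw [key]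
  refine contDiff_const.smul (hexp.smul (contDiff_integral_exp_smul ?_ ?_ fun c => ?_))
  · exact Continuous.aestronglyMeasurable (by fun_prop)
  · have := hcont a
    exact Continuous.aestronglyMeasurable (by fun_prop)
  · refine ((integrable_exp_mul_norm_mul_gaussian volume B hBpos hℏ
      (|c| * (2 / ℏ) * ‖B‖)).mul_const ‖a‖).mono' ?_ (.of_forall fun u => ?_)
    · have := hcont a
      exact Continuous.aestronglyMeasurable (by fun_prop)
    · rw [Real.norm_of_nonneg (by positivity), norm_smul (Real.exp _), hnorm,
        Real.norm_of_nonneg (Real.exp_pos _).le, ← mul_assoc, norm_smul,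
        Real.norm_of_nonneg (by positivity : 0 ≤ 2 / ℏ)]
      gcongr ?_ * _ * _
      rw [Real.exp_le_exp]
      calc c * (2 / ℏ * ‖B u‖) ≤ |c| * (2 / ℏ * (‖B‖ * ‖u‖)) := by
            gcongr
            · exact le_abs_self c
            · exact B.le_opNorm u
        _ = _ := by ring
end

section
/- Continuity in the deformation parameter: for every a ∈ A, the map ℏ ↦ S_ℏ(a) is norm-continuous on (0, ∞), and extends continuously to [0, ∞) by setting S_0(a) = a. -/
open MeasureTheory Filter

/-- The linear map `v ↦ Ω v` with `θ(u, v) = ⟨u, Ω v⟩` for the standard symplectic form `θ`. -/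
def stdSympMap (n : ℕ) : (Fin (2*n) → ℝ) →ₗ[ℝ] (Fin (2*n) → ℝ) where
  toFun v i := if h : i.1 < n then v ⟨n + i.1, by omega⟩ else -v ⟨i.1 - n, by omega⟩
  map_add' u v := by
    ext i
    by_cases h : i.1 < n <;> simp [h, add_comm]
  map_smul' c v := by
    ext i
    by_cases h : i.1 < n <;> simp [h]

lemma stdSympMap_stdSympMap {n : ℕ} (v : Fin (2*n) → ℝ) :
    stdSympMap n (stdSympMap n v) = -v := by
  ext i
  by_cases h : i.1 < n
  · simp [stdSympMap, h]
  · have h' : i.1 - n < n := by omega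
    have h'' : n + (i.1 - n) = i.1 := by omega
    simp [stdSympMap, h, h', h'']

lemma stdSymp_eq_dotProduct {n : ℕ} (u v : Fin (2*n) → ℝ) :
    stdSymp n u v = u ⬝ᵥ stdSympMap n v := by
  have h : n + n = 2 * n := by omega
  rw [dotProduct, ← Equiv.sum_comp (finCongr h), Fin.sum_univ_add, ← Finset.sum_add_distrib]
  refine Finset.sum_congr rfl fun k _ => ?_
  simp [stdSympMap, finCongr, Fin.cast, Fin.castAdd, Fin.natAdd, Fin.castLE, sub_eq_add_neg]

lemma LinearMap.abs_det_eq_one_of_apply_apply_eq_neg {n : ℕ}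
    {T : (Fin (2*n) → ℝ) →ₗ[ℝ] (Fin (2*n) → ℝ)} (hT : ∀ v, T (T v) = -v) :
    |LinearMap.det T| = 1 := by
  have h : T ∘ₗ T = (-1 : ℝ) • LinearMap.id := by
    ext1 v
    ext
    simp [hT]
  have h2 := congrArg LinearMap.det h
  rw [LinearMap.det_comp, LinearMap.det_smul] at h2
  simp only [Module.finrank_fin_fun, LinearMap.det_id, mul_one, pow_mul] at h2
  norm_num at h2
  exact (abs_eq zero_le_one).2 (mul_self_eq_one_iff.1 h2)

lemma measurePreserving_mulVec {ι : Type*} [Fintype ι] [DecidableEq ι] {B : Matrix ι ι ℝ}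
    (hB : |B.det| = 1) : MeasurePreserving (fun v : ι → ℝ => B.mulVec v) := by
  have h0 : B.det ≠ 0 := by
    intro h
    simp [h] at hB
  refine ⟨(Continuous.matrix_mulVec continuous_const continuous_id).measurable, ?_⟩
  have := Real.map_matrix_volume_pi_eq_smul_volume_pi h0
  rw [abs_inv, hB, inv_one, ENNReal.ofReal_one, one_smul] at this
  exact this

lemma measurableEmbedding_mulVec {ι : Type*} [Fintype ι] [DecidableEq ι] {B : Matrix ι ι ℝ}
    (hB : |B.det| = 1) : MeasurableEmbedding (fun v : ι → ℝ => B.mulVec v) := by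
  have h0 : IsUnit B := by
    rw [Matrix.isUnit_iff_isUnit_det, isUnit_iff_ne_zero]
    intro h
    simp [h] at hB
  exact (Continuous.matrix_mulVec continuous_const continuous_id).measurableEmbedding
    (Matrix.mulVec_injective_of_isUnit h0)

lemma exp_neg_dotProduct_self {ι : Type*} [Fintype ι] :
    (fun v : ι → ℝ => Real.exp (-(v ⬝ᵥ v))) = fun v => ∏ i, Real.exp (-1 * v i ^ 2) := by
  ext v
  rw [← Real.exp_sum, dotProduct, ← Finset.sum_neg_distrib]
  simp [sq]

open scoped MatrixOrder Matrix.Norms.L2Operator in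
lemma Matrix.PosSemidef.exists_eq_conjTranspose_mul_self {ι : Type*} [Fintype ι] [DecidableEq ι]
    {M : Matrix ι ι ℝ} (hM : M.PosSemidef) : ∃ B : Matrix ι ι ℝ, M = B.conjTranspose * B :=
  CStarAlgebra.nonneg_iff_eq_star_mul_self.mp hM.nonneg

/-- The Gaussian of a positive semidefinite matrix `M` with `|det M| = 1` is integrable, with the same
integral as the standard Gaussian. -/
lemma integrable_and_integral_exp_neg_of_posSemidef {ι : Type*} [Fintype ι] [DecidableEq ι]
    {M : Matrix ι ι ℝ} (hM : M.PosSemidef) (hdet : |M.det| = 1) :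
    Integrable (fun v : ι → ℝ => Real.exp (-(v ⬝ᵥ M.mulVec v))) ∧
      ∫ v : ι → ℝ, Real.exp (-(v ⬝ᵥ M.mulVec v)) = √Real.pi ^ Fintype.card ι := by
  obtain ⟨B, rfl⟩ := hM.exists_eq_conjTranspose_mul_self
  have hB : |B.det| = 1 := by
    rw [Matrix.det_mul, Matrix.det_conjTranspose, star_trivial, abs_mul] at hdet
    nlinarith [abs_nonneg B.det]
  have key (v : ι → ℝ) :
      v ⬝ᵥ (B.conjTranspose * B).mulVec v = B.mulVec v ⬝ᵥ B.mulVec v := by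
    rw [← Matrix.mulVec_mulVec, Matrix.dotProduct_mulVec, Matrix.vecMul_conjTranspose]
    simp
  simp_rw [key]
  constructor
  · refine ((measurePreserving_mulVec hB).integrable_comp_emb
      (measurableEmbedding_mulVec hB) (g := fun v : ι → ℝ => Real.exp (-(v ⬝ᵥ v)))).2 ?_
    rw [exp_neg_dotProduct_self]
    exact Integrable.fintype_prod fun _ => integrable_exp_neg_mul_sq one_pos
  · rw [(measurePreserving_mulVec hB).integral_comp (measurableEmbedding_mulVec hB)
      (fun v : ι → ℝ => Real.exp (-(v ⬝ᵥ v))), exp_neg_dotProduct_self,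
      integral_fintype_prod_volume_eq_pow (fun x : ℝ => Real.exp (-1 * x ^ 2)), integral_gaussian,
      div_one]

lemma smoothingOp_eq_integral_sqrt_smul {n : ℕ} {A : Type*} [NonUnitalCStarAlgebra A]
    (α : (Fin (2*n) → ℝ) → (A ≃⋆ₐ[ℂ] A)) {g : (Fin (2*n) → ℝ) → (Fin (2*n) → ℝ) → ℝ}
    (hg : ∀ (c : ℝ) u, g (c • u) (c • u) = c ^ 2 * g u u) {ℏ : ℝ} (hℏ : 0 < ℏ) (a : A) :
    smoothingOp α g ℏ a =
      (Real.pi ^ n)⁻¹ • ∫ v : Fin (2*n) → ℝ, Real.exp (-(g v v)) • α (√ℏ • v) a := by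
  have h := Measure.integral_comp_smul (volume : Measure (Fin (2*n) → ℝ))
    (fun u => Real.exp (-(g u u) / ℏ) • α u a) √ℏ
  have h1 (v : Fin (2*n) → ℝ) : -(g (√ℏ • v) (√ℏ • v)) / ℏ = -(g v v) := by
    rw [hg, Real.sq_sqrt hℏ.le]
    field_simp
  simp only [h1, Module.finrank_fin_fun, pow_mul, Real.sq_sqrt hℏ.le] at h
  rw [h, smoothingOp, smul_smul, abs_of_pos (by positivity), mul_pow, mul_inv]

/-- Averages of an orbit against a fixed integrable continuous weight depend continuously on
the scale. -/
lemma continuous_integral_smul_comp_smul {n : ℕ} {A : Type*} [NonUnitalCStarAlgebra A]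
    {α : (Fin (2*n) → ℝ) → (A ≃⋆ₐ[ℂ] A)} {a : A} (hα : Continuous fun u => α u a)
    {w : (Fin (2*n) → ℝ) → ℝ} (hw : Continuous w) (hw' : Integrable w) :
    Continuous fun c : ℝ => ∫ v : Fin (2*n) → ℝ, w v • α (c • v) a := by
  refine continuous_of_dominated (bound := fun v => ‖w v‖ * ‖a‖) (fun c => ?_) (fun c => ?_)
    (hw'.norm.mul_const _) ?_
  · exact (hw.smul (hα.comp (continuous_const_smul c))).aestronglyMeasurable
  · refine Eventually.of_forall fun v => ?_
    rw [norm_smul, StarAlgEquiv.norm_map]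
  · exact Eventually.of_forall fun v =>
      continuous_const.smul (hα.comp (continuous_id.smul continuous_const))

theorem smoothingOp_continuous_in_hbar {n : ℕ} {A : Type*} [NonUnitalCStarAlgebra A]
    -- `α` is an action of `(ℝ^{2n}, +)` by *-automorphisms ...
    (α : (Fin (2*n) → ℝ) → (A ≃⋆ₐ[ℂ] A))
    (hhom : ∀ u v : Fin (2*n) → ℝ, ∀ a : A, α (u + v) a = α u (α v a))
    -- ... which is strongly continuous:
    (hcont : ∀ a : A, Continuous fun u => α u a)
    -- `J` is a linear complex structure on `ℝ^{2n}` ...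
    (J : (Fin (2*n) → ℝ) →ₗ[ℝ] (Fin (2*n) → ℝ))
    (hJ : ∀ u, J (J u) = -u)
    -- ... compatible with the standard symplectic form `θ`, i.e. `g(u,v) = θ(u, Jv)` is a
    -- symmetric positive-definite inner product:
    (g : (Fin (2*n) → ℝ) → (Fin (2*n) → ℝ) → ℝ)
    (hg : ∀ u v, g u v = stdSymp n u (J v))
    (hgsymm : ∀ u v, g u v = g v u)
    (hgpos : ∀ u, u ≠ 0 → 0 < g u u) :
    ∀ a : A,
      -- `ℏ ↦ S_ℏ(a)` is norm-continuous on `(0, ∞)` ...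
      ContinuousOn (fun ℏ : ℝ => smoothingOp α g ℏ a) (Set.Ioi 0) ∧
      -- ... and extends continuously to `[0, ∞)` by setting `S_0(a) = a`:
      ContinuousOn (fun ℏ : ℝ => if 0 < ℏ then smoothingOp α g ℏ a else a) (Set.Ici 0) := by
  intro a
  set M : Matrix (Fin (2*n)) (Fin (2*n)) ℝ := LinearMap.toMatrix' (stdSympMap n ∘ₗ J) with hMdef
  have hgM (u v) : g u v = u ⬝ᵥ M.mulVec v := by
    rw [hg, stdSymp_eq_dotProduct, hMdef, LinearMap.toMatrix'_mulVec, LinearMap.comp_apply]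
  have hdet : |M.det| = 1 := by
    rw [hMdef, LinearMap.det_toMatrix', LinearMap.det_comp, abs_mul,
      LinearMap.abs_det_eq_one_of_apply_apply_eq_neg stdSympMap_stdSympMap,
      LinearMap.abs_det_eq_one_of_apply_apply_eq_neg hJ, one_mul]
  have hM : M.PosDef := by
    refine Matrix.PosDef.of_dotProduct_mulVec_pos ?_ fun u hu => ?_
    · ext i j
      have := hgsymm (Pi.single j 1) (Pi.single i 1)
      simpa [hgM] using this
    · simpa [hgM] using hgpos u hu
  obtain ⟨hint, hval⟩ := integrable_and_integral_exp_neg_of_posSemidef hM.posSemidef hdet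
  simp only [← hgM] at hint hval
  have hgc : Continuous fun v => Real.exp (-(g v v)) := by
    simp only [hgM]
    exact (continuous_id.dotProduct
      (continuous_const.matrix_mulVec continuous_id)).neg.rexp
  have hscale (c : ℝ) (u) : g (c • u) (c • u) = c ^ 2 * g u u := by
    simp only [hgM, Matrix.mulVec_smul, dotProduct_smul, smul_dotProduct, smul_eq_mul]
    ring
  have hα0 : α 0 a = a := (α 0).injective (show α 0 (α 0 a) = α 0 a by rw [← hhom, add_zero])
  have hF : Continuous fun ℏ : ℝ =>
      (Real.pi ^ n)⁻¹ • ∫ v : Fin (2*n) → ℝ, Real.exp (-(g v v)) • α (√ℏ • v) a :=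
    ((continuous_integral_smul_comp_smul (hcont a) hgc hint).comp
      Real.continuous_sqrt).const_smul _
  refine ⟨hF.continuousOn.congr fun ℏ hℏ => smoothingOp_eq_integral_sqrt_smul α hscale hℏ a,
    hF.continuousOn.congr fun ℏ hℏ => ?_⟩
  rcases (Set.mem_Ici.1 hℏ).eq_or_lt with rfl | hpos
  · simp only [lt_irrefl, if_false, Real.sqrt_zero, zero_smul, hα0]
    rw [integral_smul_const, hval, Fintype.card_fin, pow_mul, Real.sq_sqrt Real.pi_pos.le,
      inv_smul_smul₀ (by positivity)]
  · simp only [hpos, if_true]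
    exact smoothingOp_eq_integral_sqrt_smul α hscale hpos a
end

section
/- Heat-equation property: for every smooth vector a ∈ A^∞, the map ℏ ↦ S_ℏ(a) is differentiable on (0, ∞) with derivative d/dℏ S_ℏ(a) = (1/4) S_ℏ(Δ_g a) in the norm of A, where Δ_g is the Laplacian associated to g and the action. -/
open MeasureTheory Filter

/-- The `k`-th standard basis vector of `ℝ^{2n}`. -/
noncomputable def basisVec (n : ℕ) (k : Fin (2*n)) : Fin (2*n) → ℝ := Pi.single k 1

/-- The derivative `∂_k b = d/dt|_{t=0} α_{t e_k}(b)` of the action in the direction of the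
`k`-th standard basis vector. -/
noncomputable def actDeriv {n : ℕ} {A : Type*} [NonUnitalCStarAlgebra A]
    (α : (Fin (2*n) → ℝ) → (A ≃⋆ₐ[ℂ] A)) (k : Fin (2*n)) (a : A) : A :=
  deriv (fun t : ℝ => α (t • basisVec n k) a) 0

/-- The Laplacian `Δ_g a = Σ_{k,l} g^{kl} ∂_k ∂_l a` associated to `g` and the action, where
`(g^{kl})` is the inverse of the matrix `(g(e_k, e_l))`. -/
noncomputable def actLaplacian {n : ℕ} {A : Type*} [NonUnitalCStarAlgebra A]
    (α : (Fin (2*n) → ℝ) → (A ≃⋆ₐ[ℂ] A)) (g : (Fin (2*n) → ℝ) → (Fin (2*n) → ℝ) → ℝ)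
    (a : A) : A :=
  ∑ k : Fin (2*n), ∑ l : Fin (2*n),
    ((Matrix.of fun i j => g (basisVec n i) (basisVec n j))⁻¹ k l) •
      actDeriv α k (actDeriv α l a)

theorem isCoercive_of_forall_pos {E : Type*} [NormedAddCommGroup E] [NormedSpace ℝ E]
    [FiniteDimensional ℝ E] (B : E →L[ℝ] E →L[ℝ] ℝ) (hB : ∀ u, u ≠ 0 → 0 < B u u) :
    IsCoercive B := by
  have : ProperSpace E := FiniteDimensional.proper ℝ E
  obtain ⟨c, hc, hle⟩ := (isCompact_sphere (0 : E) 1).exists_forall_le'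
    (f := fun u => B u u) (a := 0) (by fun_prop)
    (fun u hu => hB u (by rintro rfl; simp at hu))
  refine ⟨c, hc, fun u => ?_⟩
  rcases eq_or_ne u 0 with rfl | hu
  · simp
  have hu' : ‖u‖ ≠ 0 := norm_ne_zero_iff.2 hu
  have h := hle (‖u‖⁻¹ • u) (by simp [norm_smul, hu'])
  simp only [map_smul, smul_apply, smul_eq_mul] at h
  calc c * ‖u‖ * ‖u‖ ≤ (‖u‖⁻¹ * (‖u‖⁻¹ * B u u)) * ‖u‖ * ‖u‖ := by gcongr
    _ = B u u := by field_simp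

theorem integrable_exp_neg_mul_norm_sq {ι : Type*} [Fintype ι] {b : ℝ} (hb : 0 < b) :
    Integrable fun u : ι → ℝ => Real.exp (-b * ‖u‖ ^ 2) := by
  set c : ℝ := b / (Fintype.card ι + 1) with hc
  have hc0 : 0 < c := by positivity
  have h := Integrable.fintype_prod (ι := ι) (μ := fun _ => volume)
    (f := fun _ (x : ℝ) => Real.exp (-c * x ^ 2)) (fun _ => integrable_exp_neg_mul_sq hc0)
  rw [← volume_pi] at h
  refine h.mono' (by fun_prop) (.of_forall fun u => ?_)
  rw [Real.norm_of_nonneg (Real.exp_pos _).le, ← Real.exp_sum, Real.exp_le_exp, ← Finset.mul_sum]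
  have hsum : ∑ i, u i ^ 2 ≤ Fintype.card ι * ‖u‖ ^ 2 := by
    calc ∑ i, u i ^ 2 ≤ ∑ _i : ι, ‖u‖ ^ 2 := Finset.sum_le_sum fun i _ => by
          rw [← sq_abs (u i), ← Real.norm_eq_abs]
          gcongr
          exact norm_le_pi_norm u i
      _ = Fintype.card ι * ‖u‖ ^ 2 := by simp
  have hb' : b = c * (Fintype.card ι + 1) := by rw [hc]; field_simp
  rw [hb']
  nlinarith [mul_le_mul_of_nonneg_left hsum hc0.le, mul_nonneg hc0.le (sq_nonneg ‖u‖)]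

theorem IsCoercive.integrable_one_add_norm_mul_exp_neg {ι : Type*} [Fintype ι]
    {B : (ι → ℝ) →L[ℝ] (ι → ℝ) →L[ℝ] ℝ} (hB : IsCoercive B) :
    Integrable fun u : ι → ℝ => (1 + ‖u‖) * Real.exp (-B u u) := by
  obtain ⟨c, hc, hle⟩ := hB
  refine ((integrable_exp_neg_mul_norm_sq (ι := ι) (half_pos hc)).const_mul (2 + 2 / c)).mono'
    (Continuous.aestronglyMeasurable (by fun_prop)) (.of_forall fun u => ?_)
  rw [Real.norm_of_nonneg (by positivity)]
  have h1 : 1 + ‖u‖ ≤ (2 + 2 / c) * Real.exp (c / 2 * ‖u‖ ^ 2) := by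
    calc 1 + ‖u‖ ≤ (2 + 2 / c) * (c / 2 * ‖u‖ ^ 2 + 1) := by
          have : (2 + 2 / c) * (c / 2 * ‖u‖ ^ 2 + 1)
              = c * ‖u‖ ^ 2 + 2 + ‖u‖ ^ 2 + 2 / c := by field_simp; ring
          rw [this]
          have h2 : 0 < 2 / c := by positivity
          nlinarith [sq_nonneg (‖u‖ - 1), mul_nonneg hc.le (sq_nonneg ‖u‖)]
      _ ≤ _ := by
          gcongr
          exact Real.add_one_le_exp _
  calc (1 + ‖u‖) * Real.exp (-B u u)
      ≤ ((2 + 2 / c) * Real.exp (c / 2 * ‖u‖ ^ 2)) * Real.exp (-(c * ‖u‖ * ‖u‖)) := by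
        gcongr
        exact hle u
    _ = (2 + 2 / c) * Real.exp (-(c / 2) * ‖u‖ ^ 2) := by
        rw [mul_assoc, ← Real.exp_add]; ring_nf

theorem IsCoercive.integrable_of_norm_le {ι : Type*} [Fintype ι] {E : Type*}
    [NormedAddCommGroup E] {B : (ι → ℝ) →L[ℝ] (ι → ℝ) →L[ℝ] ℝ} (hB : IsCoercive B)
    {f : (ι → ℝ) → E} (hf : Continuous f) (K : ℝ)
    (hle : ∀ u, ‖f u‖ ≤ K * ((1 + ‖u‖) * Real.exp (-B u u))) : Integrable f :=
  (hB.integrable_one_add_norm_mul_exp_neg.const_mul K).mono' hf.aestronglyMeasurable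
    (.of_forall hle)

/-- Integration by parts against a Gaussian, in the direction `v`. -/
theorem IsCoercive.integral_exp_neg_smul_fderiv {ι : Type*} [Fintype ι] {E : Type*}
    [NormedAddCommGroup E] [NormedSpace ℝ E] {B : (ι → ℝ) →L[ℝ] (ι → ℝ) →L[ℝ] ℝ}
    (hB : IsCoercive B) (hsymm : ∀ u v, B u v = B v u) {f : (ι → ℝ) → E} (hf : ContDiff ℝ 1 f)
    (v : ι → ℝ) {K : ℝ} (hK : ∀ u, ‖f u‖ ≤ K) {K' : ℝ} (hK' : ∀ u, ‖fderiv ℝ f u v‖ ≤ K') :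
    ∫ u, Real.exp (-B u u) • fderiv ℝ f u v
      = (2 : ℝ) • ∫ u, (B v u * Real.exp (-B u u)) • f u := by
  have hd : ∀ u, HasFDerivAt (fun u => Real.exp (-B u u))
      (Real.exp (-B u u) • -(B u + B.flip u)) u := fun u => by
    have h := (B.hasFDerivAt_of_bilinear (hasFDerivAt_id u) (hasFDerivAt_id u)).neg.exp
    refine HasFDerivAt.congr_fderiv (f := fun u => Real.exp (-B u u)) h ?_
    ext x
    simp
  have hd' : ∀ u, fderiv ℝ (fun u => Real.exp (-B u u)) u v
      = -(2 * (B v u * Real.exp (-B u u))) := fun u => by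
    rw [(hd u).fderiv]
    simp [hsymm u v]
    ring
  have hK0 : 0 ≤ K := (norm_nonneg _).trans (hK 0)
  have hK0' : 0 ≤ K' := (norm_nonneg _).trans (hK' 0)
  have hexp : ∀ u, Real.exp (-B u u) ≤ (1 + ‖u‖) * Real.exp (-B u u) := fun u =>
    le_mul_of_one_le_left (Real.exp_pos _).le (by linarith [norm_nonneg u])
  have hcf := hf.continuous
  have hcf' : Continuous fun u => fderiv ℝ f u v :=
    (hf.continuous_fderiv one_ne_zero).clm_apply continuous_const
  rw [integral_smul_fderiv_eq_neg_fderiv_smul_of_integrable]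
  · simp_rw [hd', neg_smul, integral_neg, neg_neg, mul_smul (2 : ℝ), integral_smul]
  · simp_rw [hd']
    refine hB.integrable_of_norm_le (by fun_prop) (2 * ‖B v‖ * K) fun u => ?_
    rw [norm_smul, norm_neg, norm_mul, norm_mul, Real.norm_of_nonneg (Real.exp_pos _).le,
      Real.norm_of_nonneg (zero_le_two)]
    calc 2 * (‖B v u‖ * Real.exp (-B u u)) * ‖f u‖
        ≤ 2 * ((‖B v‖ * (1 + ‖u‖)) * Real.exp (-B u u)) * K := by
          gcongr
          · exact ((B v).le_opNorm u).trans (by gcongr; linarith)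
          · exact hK u
      _ = _ := by ring
  · refine hB.integrable_of_norm_le (by fun_prop) K' fun u => ?_
    rw [norm_smul, Real.norm_of_nonneg (Real.exp_pos _).le, mul_comm]
    exact mul_le_mul (hK' u) (hexp u) (Real.exp_pos _).le hK0'
  · refine hB.integrable_of_norm_le (by fun_prop) K fun u => ?_
    rw [norm_smul, Real.norm_of_nonneg (Real.exp_pos _).le, mul_comm]
    exact mul_le_mul (hK u) (hexp u) (Real.exp_pos _).le hK0
  · exact fun u _ => (hd u).differentiableAt
  · exact fun u _ => hf.differentiable one_ne_zero u

theorem sum_inv_gram_mul {ι : Type*} [Fintype ι] [DecidableEq ι]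
    (B : (ι → ℝ) →L[ℝ] (ι → ℝ) →L[ℝ] ℝ) (hB : ∀ u, u ≠ 0 → 0 < B u u) (w : ι → ℝ) (k : ι) :
    B (∑ l, (Matrix.of fun i j => B (Pi.single i 1) (Pi.single j 1))⁻¹ k l • Pi.single l 1) w
      = w k := by
  set G : Matrix ι ι ℝ := Matrix.of fun i j => B (Pi.single i 1) (Pi.single j 1) with hG
  have hmul : ∀ v i, G.mulVec v i = B (Pi.single i 1) v := fun v i => by
    conv_rhs => rw [pi_eq_sum_univ' v, map_sum]
    simp only [Matrix.mulVec, dotProduct, hG, Matrix.of_apply, map_smul, smul_eq_mul]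
    exact Finset.sum_congr rfl fun j _ => by
      rw [mul_comm]
  have hdet : IsUnit G.det := by
    rw [isUnit_iff_ne_zero, Ne, ← Matrix.exists_mulVec_eq_zero_iff]
    rintro ⟨v, hv, hGv⟩
    refine (hB v hv).ne' ?_
    refine (congrArg (fun x => B x v) (pi_eq_sum_univ' v)).trans ?_
    simp only [map_sum, sum_apply, map_smul, smul_apply]
    refine Finset.sum_eq_zero fun i _ => ?_
    have hi := hmul v i
    rw [hGv, Pi.zero_apply] at hi
    rw [← hi, smul_zero]
  have h : G⁻¹.mulVec (G.mulVec w) k = w k := by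
    rw [Matrix.mulVec_mulVec, Matrix.nonsing_inv_mul _ hdet, Matrix.one_mulVec]
  rw [← h]
  simp [Matrix.mulVec, dotProduct, ← hmul]

section Action

variable {n : ℕ} {A : Type*} [NonUnitalCStarAlgebra A]

/-- A `*`-automorphism of a C⋆-algebra as a continuous real-linear map. -/
noncomputable def StarAlgEquiv.realCLM (φ : A ≃⋆ₐ[ℂ] A) : A →L[ℝ] A where
  toFun := φ
  map_add' := map_add φ
  map_smul' r a := by
    simp only [← Complex.coe_smul, map_smul, RingHom.id_apply]
  cont := (StarAlgEquiv.isometry φ).continuous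

@[simp]
theorem StarAlgEquiv.realCLM_apply (φ : A ≃⋆ₐ[ℂ] A) (a : A) : φ.realCLM a = φ a := rfl

variable {α : (Fin (2*n) → ℝ) → (A ≃⋆ₐ[ℂ] A)}

theorem fderiv_action_basisVec
    (hhom : ∀ u v : Fin (2*n) → ℝ, ∀ a : A, α (u + v) a = α u (α v a)) {a : A}
    (ha : ContDiff ℝ (⊤ : ℕ∞) fun u => α u a) (u : Fin (2*n) → ℝ) (k : Fin (2*n)) :
    fderiv ℝ (fun u => α u a) u (basisVec n k) = α u (actDeriv α k a) := by
  have hline : ∀ v, HasDerivAt (fun t : ℝ => α (v + t • basisVec n k) a)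
      (fderiv ℝ (fun u => α u a) v (basisVec n k)) 0 := fun v =>
    (ha.differentiable (by simp) v).hasFDerivAt.hasLineDerivAt (basisVec n k)
  have h0 := (hline 0).differentiableAt.hasDerivAt
  simp only [zero_add] at h0
  have h1 := (α u).realCLM.hasFDerivAt.comp_hasDerivAt 0 h0
  refine (hline u).unique ?_
  rw [actDeriv, ← StarAlgEquiv.realCLM_apply]
  refine h1.congr_of_eventuallyEq (.of_forall fun t => ?_)
  exact hhom _ _ _

theorem contDiff_action_actDeriv
    (hhom : ∀ u v : Fin (2*n) → ℝ, ∀ a : A, α (u + v) a = α u (α v a)) {a : A}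
    (ha : ContDiff ℝ (⊤ : ℕ∞) fun u => α u a) (k : Fin (2*n)) :
    ContDiff ℝ (⊤ : ℕ∞) fun u => α u (actDeriv α k a) := by
  simp_rw [← fderiv_action_basisVec hhom ha]
  exact (ha.fderiv_right (by simp)).clm_apply contDiff_const

theorem fderiv_action
    (hhom : ∀ u v : Fin (2*n) → ℝ, ∀ a : A, α (u + v) a = α u (α v a)) {a : A}
    (ha : ContDiff ℝ (⊤ : ℕ∞) fun u => α u a) (u v : Fin (2*n) → ℝ) :
    fderiv ℝ (fun u => α u a) u v = ∑ k, v k • α u (actDeriv α k a) := by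
  have hv : v = ∑ k, v k • basisVec n k := by
    ext i
    simp [basisVec, Pi.single_apply]
  conv_lhs => rw [hv]
  simp only [map_sum, map_smul, fderiv_action_basisVec hhom ha]

theorem smoothingOp_eq_integral_sqrt (B : (Fin (2*n) → ℝ) →L[ℝ] (Fin (2*n) → ℝ) →L[ℝ] ℝ)
    {h : ℝ} (hh : 0 < h) (a : A) :
    smoothingOp α (fun u v => B u v) h a
      = (Real.pi ^ n)⁻¹ • ∫ w, Real.exp (-B w w) • α (√h • w) a := by
  have hs : √h ≠ 0 := (Real.sqrt_pos.2 hh).ne'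
  have key := Measure.integral_comp_smul volume
    (fun u : Fin (2*n) → ℝ => Real.exp (-(B u u) / h) • α u a) √h
  have hexp : ∀ w, -(B (√h • w) (√h • w)) / h = -B w w := fun w => by
    simp only [map_smul, smul_apply, smul_eq_mul]
    rw [← mul_assoc, Real.mul_self_sqrt hh.le]
    field_simp
  simp only [hexp, Module.finrank_fin_fun, pow_mul, Real.sq_sqrt hh.le] at key
  rw [key, smoothingOp, smul_smul, abs_of_pos (by positivity), mul_pow, mul_inv]

theorem hasDerivAt_integral_exp_neg_smul_action
    (hhom : ∀ u v : Fin (2*n) → ℝ, ∀ a : A, α (u + v) a = α u (α v a))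
    {B : (Fin (2*n) → ℝ) →L[ℝ] (Fin (2*n) → ℝ) →L[ℝ] ℝ} (hB : IsCoercive B) {a : A}
    (ha : ContDiff ℝ (⊤ : ℕ∞) fun u => α u a) (s : ℝ) :
    HasDerivAt (fun s : ℝ => ∫ w, Real.exp (-B w w) • α (s • w) a)
      (∫ w, Real.exp (-B w w) • ∑ k, w k • α (s • w) (actDeriv α k a)) s := by
  set C : ℝ := ∑ k, ‖actDeriv α k a‖ with hC
  have hc := ha.continuous
  have hc' : ∀ k, Continuous fun u => α u (actDeriv α k a) := fun k =>
    (contDiff_action_actDeriv hhom ha k).continuous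
  have hsum : ∀ (s : ℝ) (w : Fin (2*n) → ℝ),
      ‖∑ k, w k • α (s • w) (actDeriv α k a)‖ ≤ C * (1 + ‖w‖) := fun s w => by
    refine (norm_sum_le _ _).trans ?_
    rw [hC, Finset.sum_mul]
    refine Finset.sum_le_sum fun k _ => ?_
    rw [norm_smul, StarAlgEquiv.norm_map, mul_comm]
    gcongr
    linarith [norm_le_pi_norm w k]
  have hcs : ∀ s : ℝ, Continuous fun w => Real.exp (-B w w) • α (s • w) a := fun s => by
    have : Continuous fun w => α (s • w) a := hc.comp (by fun_prop)
    fun_prop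
  have hcs' : ∀ s : ℝ,
      Continuous fun w => Real.exp (-B w w) • ∑ k, w k • α (s • w) (actDeriv α k a) := fun s => by
    have : ∀ k, Continuous fun w => α (s • w) (actDeriv α k a) :=
      fun k => (hc' k).comp (by fun_prop)
    fun_prop
  refine (hasDerivAt_integral_of_dominated_loc_of_deriv_le (s := Set.univ) univ_mem
    (F := fun s w => Real.exp (-B w w) • α (s • w) a)
    (F' := fun s w => Real.exp (-B w w) • ∑ k, w k • α (s • w) (actDeriv α k a))
    (.of_forall fun s => (hcs s).aestronglyMeasurable) ?_ (hcs' s).aestronglyMeasurable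
    (.of_forall fun w s _ => ?_) (hB.integrable_one_add_norm_mul_exp_neg.const_mul C)
    (.of_forall fun w s _ => ?_)).2
  · refine hB.integrable_of_norm_le (hcs s) ‖a‖ fun w => ?_
    rw [norm_smul, StarAlgEquiv.norm_map, mul_comm, Real.norm_of_nonneg (Real.exp_pos _).le]
    gcongr
    exact le_mul_of_one_le_left (Real.exp_pos _).le (by linarith [norm_nonneg w])
  · rw [norm_smul, Real.norm_of_nonneg (Real.exp_pos _).le, mul_comm, ← mul_assoc]
    gcongr
    exact hsum s w
  · rw [← fderiv_action hhom ha]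
    have h1 : HasDerivAt (fun t : ℝ => t • w) w s := by
      simpa using (hasDerivAt_id s).smul_const w
    exact ((ha.differentiable (by simp) (s • w)).hasFDerivAt.comp_hasDerivAt s h1).const_smul
      (Real.exp (-B w w))

theorem integral_coord_mul_exp_neg_smul_action
    (hhom : ∀ u v : Fin (2*n) → ℝ, ∀ a : A, α (u + v) a = α u (α v a))
    {B : (Fin (2*n) → ℝ) →L[ℝ] (Fin (2*n) → ℝ) →L[ℝ] ℝ} (hsymm : ∀ u v, B u v = B v u)
    (hpos : ∀ u, u ≠ 0 → 0 < B u u) {b : A} (hb : ContDiff ℝ (⊤ : ℕ∞) fun u => α u b) (s : ℝ)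
    (k : Fin (2*n)) :
    (2 : ℝ) • ∫ w, (w k * Real.exp (-B w w)) • α (s • w) b
      = s • ∫ w, Real.exp (-B w w) • α (s • w)
        (∑ l, (Matrix.of fun i j => B (basisVec n i) (basisVec n j))⁻¹ k l • actDeriv α l b) := by
  set G := (Matrix.of fun i j => B (basisVec n i) (basisVec n j)) with hG
  set v : Fin (2*n) → ℝ := ∑ l, G⁻¹ k l • basisVec n l with hv
  set c : A := ∑ l, G⁻¹ k l • actDeriv α l b with hc
  have hBv : ∀ w, B v w = w k := fun w => sum_inv_gram_mul B hpos w k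
  have hfd : ∀ w, fderiv ℝ (fun w => α (s • w) b) w v = s • α (s • w) c := fun w => by
    have h1 : HasFDerivAt (fun w : Fin (2*n) → ℝ => s • w)
        (s • ContinuousLinearMap.id ℝ (Fin (2*n) → ℝ)) w := (hasFDerivAt_id w).const_smul s
    have h2 := (hb.differentiable (by simp) (s • w)).hasFDerivAt.comp w h1
    have h3 := h2.fderiv
    simp only [Function.comp_def] at h3
    rw [h3]
    simp only [ContinuousLinearMap.comp_apply, smul_apply,
      ContinuousLinearMap.id_apply, map_smul, hv, map_sum, fderiv_action_basisVec hhom hb]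
    simp only [hc, ← StarAlgEquiv.realCLM_apply, map_sum, map_smul, Finset.smul_sum, smul_comm s]
  have hcd : ContDiff ℝ 1 fun w => α (s • w) b :=
    (hb.of_le (by simp)).comp (contDiff_const_smul s)
  have := (isCoercive_of_forall_pos B hpos).integral_exp_neg_smul_fderiv hsymm hcd v
    (K := ‖b‖) (fun w => (StarAlgEquiv.norm_map _ _).le) (K' := ‖s‖ * ‖c‖)
    (fun w => by rw [hfd, norm_smul, StarAlgEquiv.norm_map])
  simp only [hfd, hBv] at this
  rw [← this, ← integral_smul]
  simp only [smul_comm s]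

theorem integral_exp_neg_smul_sum_coord_smul_action
    (hhom : ∀ u v : Fin (2*n) → ℝ, ∀ a : A, α (u + v) a = α u (α v a))
    {B : (Fin (2*n) → ℝ) →L[ℝ] (Fin (2*n) → ℝ) →L[ℝ] ℝ} (hsymm : ∀ u v, B u v = B v u)
    (hpos : ∀ u, u ≠ 0 → 0 < B u u) {a : A} (ha : ContDiff ℝ (⊤ : ℕ∞) fun u => α u a) (s : ℝ) :
    ∫ w, Real.exp (-B w w) • ∑ k, w k • α (s • w) (actDeriv α k a)
      = (s / 2) • ∫ w, Real.exp (-B w w) • α (s • w) (actLaplacian α (fun u v => B u v) a) := by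
  have hB := isCoercive_of_forall_pos B hpos
  have hint : ∀ k, Integrable fun w : Fin (2*n) → ℝ =>
      (w k * Real.exp (-B w w)) • α (s • w) (actDeriv α k a) := fun k => by
    have : Continuous fun w : Fin (2*n) → ℝ => α (s • w) (actDeriv α k a) :=
      (contDiff_action_actDeriv hhom ha k).continuous.comp (by fun_prop)
    have hcw : Continuous fun w : Fin (2*n) → ℝ => w k * Real.exp (-B w w) := by fun_prop
    refine hB.integrable_of_norm_le (hcw.smul this) ‖actDeriv α k a‖ fun w => ?_
    rw [norm_smul, StarAlgEquiv.norm_map, mul_comm, norm_mul,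
      Real.norm_of_nonneg (Real.exp_pos _).le]
    gcongr
    linarith [norm_le_pi_norm w k]
  have hint' : ∀ b : A, (Continuous fun u => α u b) → Integrable fun w : Fin (2*n) → ℝ =>
      Real.exp (-B w w) • α (s • w) b := fun b hb => by
    have : Continuous fun w : Fin (2*n) → ℝ => α (s • w) b := hb.comp (by fun_prop)
    refine hB.integrable_of_norm_le (by fun_prop) ‖b‖ fun w => ?_
    rw [norm_smul, StarAlgEquiv.norm_map, mul_comm, Real.norm_of_nonneg (Real.exp_pos _).le]
    gcongr
    exact le_mul_of_one_le_left (Real.exp_pos _).le (by linarith [norm_nonneg w])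
  set G := (Matrix.of fun i j => B (basisVec n i) (basisVec n j)) with hG
  have hGsymm : G⁻¹.transpose = G⁻¹ := by
    rw [Matrix.transpose_nonsing_inv]
    congr 1
    ext i j
    exact hsymm _ _
  have hlap : actLaplacian α (fun u v => B u v) a
      = ∑ k, ∑ l, G⁻¹ k l • actDeriv α l (actDeriv α k a) := by
    rw [actLaplacian, Finset.sum_comm]
    refine Finset.sum_congr rfl fun k _ => Finset.sum_congr rfl fun l _ => ?_
    exact congrArg (· • actDeriv α l (actDeriv α k a)) (congrFun₂ hGsymm k l)
  calc _ = ∑ k, ∫ w, (w k * Real.exp (-B w w)) • α (s • w) (actDeriv α k a) := by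
        rw [← integral_finsetSum _ fun k _ => hint k]
        congr 1
        ext w
        simp only [Finset.smul_sum, smul_smul, mul_comm]
    _ = ∑ k, (s / 2) • ∫ w, Real.exp (-B w w) • α (s • w)
          (∑ l, G⁻¹ k l • actDeriv α l (actDeriv α k a)) := by
        refine Finset.sum_congr rfl fun k _ => ?_
        rw [div_eq_inv_mul, mul_smul, ← integral_coord_mul_exp_neg_smul_action hhom hsymm hpos
          (contDiff_action_actDeriv hhom ha k), smul_smul, inv_mul_cancel₀ two_ne_zero, one_smul]
    _ = _ := by
        rw [← Finset.smul_sum, ← integral_finsetSum, hlap]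
        · simp only [map_sum, Finset.smul_sum]
        · refine fun k _ => hint' _ ?_
          simp only [← StarAlgEquiv.realCLM_apply, map_sum, map_smul]
          simp only [StarAlgEquiv.realCLM_apply]
          have : ∀ l, Continuous fun u => α u (actDeriv α l (actDeriv α k a)) := fun l =>
            (contDiff_action_actDeriv hhom (contDiff_action_actDeriv hhom ha k) l).continuous
          fun_prop

end Action

theorem smoothingOp_heat_equation {n : ℕ} {A : Type*} [NonUnitalCStarAlgebra A]
    -- `α` is an action of `(ℝ^{2n}, +)` by *-automorphisms ...
    (α : (Fin (2*n) → ℝ) → (A ≃⋆ₐ[ℂ] A))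
    (hhom : ∀ u v : Fin (2*n) → ℝ, ∀ a : A, α (u + v) a = α u (α v a))
    -- ... which is strongly continuous:
    (hcont : ∀ a : A, Continuous fun u => α u a)
    -- `J` is a linear complex structure on `ℝ^{2n}` ...
    (J : (Fin (2*n) → ℝ) →ₗ[ℝ] (Fin (2*n) → ℝ))
    (hJ : ∀ u, J (J u) = -u)
    -- ... compatible with the standard symplectic form `θ`, i.e. `g(u,v) = θ(u, Jv)` is a
    -- symmetric positive-definite inner product:
    (g : (Fin (2*n) → ℝ) → (Fin (2*n) → ℝ) → ℝ)
    (hg : ∀ u v, g u v = stdSymp n u (J v))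
    (hgsymm : ∀ u v, g u v = g v u)
    (hgpos : ∀ u, u ≠ 0 → 0 < g u u) :
    -- for smooth vectors, `ℏ ↦ S_ℏ(a)` solves the heat equation
    -- `d/dℏ S_ℏ(a) = (1/4) S_ℏ(Δ_g a)` on `(0, ∞)`:
    ∀ a : A, ContDiff ℝ (⊤ : ℕ∞) (fun u : Fin (2*n) → ℝ => α u a) →
      ∀ ℏ : ℝ, 0 < ℏ →
        HasDerivAt (fun h : ℝ => smoothingOp α g h a)
          ((1/4 : ℝ) • smoothingOp α g ℏ (actLaplacian α g a)) ℏ := by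
  intro a ha ℏ hℏ
  let B : (Fin (2*n) → ℝ) →L[ℝ] (Fin (2*n) → ℝ) →L[ℝ] ℝ :=
    (LinearMap.mk₂ ℝ g
      (fun u u' v => by
        simp only [hg, stdSymp, Pi.add_apply, ← Finset.sum_add_distrib]
        exact Finset.sum_congr rfl fun _ _ => by ring)
      (fun c u v => by
        simp only [hg, stdSymp, Pi.smul_apply, smul_eq_mul, Finset.mul_sum]
        exact Finset.sum_congr rfl fun _ _ => by ring)
      (fun u v v' => by
        simp only [hg, stdSymp, map_add, Pi.add_apply, ← Finset.sum_add_distrib]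
        exact Finset.sum_congr rfl fun _ _ => by ring)
      (fun c u v => by
        simp only [hg, stdSymp, map_smul, Pi.smul_apply, smul_eq_mul, Finset.mul_sum]
        exact Finset.sum_congr rfl fun _ _ => by ring)).toContinuousBilinearMap
  change HasDerivAt (fun h => smoothingOp α (fun u v => B u v) h a)
    ((1 / 4 : ℝ) • smoothingOp α (fun u v => B u v) ℏ (actLaplacian α (fun u v => B u v) a)) ℏ
  have hBsymm : ∀ u v, B u v = B v u := hgsymm
  have hBpos : ∀ u, u ≠ 0 → 0 < B u u := hgpos
  clear_value B
  have hs : 0 < √ℏ := Real.sqrt_pos.2 hℏ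
  have hd := ((hasDerivAt_integral_exp_neg_smul_action hhom (isCoercive_of_forall_pos B hBpos) ha
    √ℏ).scomp ℏ (Real.hasDerivAt_sqrt hℏ.ne')).const_smul (Real.pi ^ n)⁻¹
  rw [integral_exp_neg_smul_sum_coord_smul_action hhom hBsymm hBpos ha, smul_smul, smul_smul,
    mul_assoc,
    show 1 / (2 * √ℏ) * (√ℏ / 2) = 1 / 4 by field_simp; norm_num,
    mul_comm _ (1 / 4 : ℝ), mul_smul,
    ← smoothingOp_eq_integral_sqrt B hℏ] at hd
  refine hd.congr_of_eventuallyEq ?_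
  filter_upwards [lt_mem_nhds hℏ] with h hh
  exact smoothingOp_eq_integral_sqrt B hh a
end

section
/- Convergence and positivity of the Wick-type series: for every ℏ > 0 and every smooth vector a ∈ A^∞, the series (1/(πℏ)^n) Σ_{K} (1/K!) (2/ℏ)^{|K|} a_K* a_K, where the sum runs over all multi-indices K = (k_1, …, k_n) and a_K = ∫_{ℂ^n} z_1^{k_1} ⋯ z_n^{k_n} e^{−(|z_1|² + ⋯ + |z_n|²)/ℏ} α_{z_1 e_1 + ⋯ + z_n e_n}(a) dz (a Bochner integral over ℂ^n with Lebesgue measure), converges absolutely in the norm of A, and its sum is a positive element of A. -/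
open MeasureTheory Filter

/-- The Gaussian coefficient
`a_K = ∫_{ℂ^n} z_1^{k_1} ⋯ z_n^{k_n} e^{-(|z_1|² + ⋯ + |z_n|²)/ℏ} α_{Σ_j (Re z_j) e_j + (Im z_j) J e_j}(a) dz`,
where `f j` plays the role of `e_j` and `Jf j` that of `J e_j`. -/
noncomputable def wickCoeff {n : ℕ} {A : Type*} [NonUnitalCStarAlgebra A]
    (α : (Fin (2*n) → ℝ) → (A ≃⋆ₐ[ℂ] A)) (f Jf : Fin n → (Fin (2*n) → ℝ))
    (ℏ : ℝ) (a : A) (K : Fin n → ℕ) : A :=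
  ∫ z : Fin n → ℂ,
    ((∏ j, z j ^ K j) * (Real.exp (-(∑ j, Complex.normSq (z j)) / ℏ) : ℂ)) •
      α (∑ j, ((z j).re • f j + (z j).im • Jf j)) a

/-- The `K`-th term `(1/(πℏ)^n) (1/K!) (2/ℏ)^{|K|} a_K* a_K` of the Wick-type series. -/
noncomputable def wickTerm {n : ℕ} {A : Type*} [NonUnitalCStarAlgebra A]
    (α : (Fin (2*n) → ℝ) → (A ≃⋆ₐ[ℂ] A)) (f Jf : Fin n → (Fin (2*n) → ℝ))
    (ℏ : ℝ) (a : A) (K : Fin n → ℕ) : A :=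
  (((Real.pi * ℏ) ^ n)⁻¹ * ((∏ j, (K j).factorial : ℕ) : ℝ)⁻¹ * (2 / ℏ) ^ (∑ j, K j)) •
    (star (wickCoeff α f Jf ℏ a K) * wickCoeff α f Jf ℏ a K)

/-- The one-variable weight `ζ^k e^{-|ζ|²/ℏ}` on `ℂ`. -/
noncomputable def gaussMonomial (ℏ : ℝ) (k : ℕ) (ζ : ℂ) : ℂ :=
  ζ ^ k * (Real.exp (-Complex.normSq ζ / ℏ) : ℂ)

/-- The absolute moment `∫_ℂ |ζ|^k e^{-|ζ|²/ℏ} dζ`. -/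
noncomputable def gaussMoment (ℏ : ℝ) (k : ℕ) : ℝ :=
  ∫ ζ : ℂ, ‖gaussMonomial ℏ k ζ‖

theorem gaussMoment_nonneg (ℏ : ℝ) (k : ℕ) : 0 ≤ gaussMoment ℏ k :=
  integral_nonneg fun _ => norm_nonneg _

theorem norm_gaussMonomial (ℏ : ℝ) (k : ℕ) (ζ : ℂ) :
    ‖gaussMonomial ℏ k ζ‖ = ‖ζ‖ ^ (k : ℝ) * Real.exp (-ℏ⁻¹ * ‖ζ‖ ^ (2 : ℝ)) := by
  rw [gaussMonomial, norm_mul, norm_pow, Complex.norm_real, Real.norm_of_nonneg (Real.exp_pos _).le,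
    Complex.normSq_eq_norm_sq, Real.rpow_natCast, Real.rpow_ofNat]
  congr 2
  ring

theorem gaussMoment_eq {ℏ : ℝ} (hℏ : 0 < ℏ) (k : ℕ) :
    gaussMoment ℏ k =
      Real.pi * ℏ⁻¹ ^ (-((k : ℝ) + 2) / 2) * Real.Gamma (((k : ℝ) + 2) / 2) := by
  simp_rw [gaussMoment, norm_gaussMonomial]
  rw [Complex.integral_rpow_mul_exp_neg_mul_rpow one_le_two
    (by linarith [k.cast_nonneg (α := ℝ)]) (inv_pos.2 hℏ)]
  congr 2
  ring

theorem gaussMoment_pos {ℏ : ℝ} (hℏ : 0 < ℏ) (k : ℕ) : 0 < gaussMoment ℏ k := by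
  rw [gaussMoment_eq hℏ]
  have := Real.Gamma_pos_of_pos (s := ((k : ℝ) + 2) / 2) (by positivity)
  positivity

theorem gaussMoment_add_two {ℏ : ℝ} (hℏ : 0 < ℏ) (k : ℕ) :
    gaussMoment ℏ (k + 2) = ℏ * ((k : ℝ) + 2) / 2 * gaussMoment ℏ k := by
  rw [gaussMoment_eq hℏ, gaussMoment_eq hℏ]
  have h1 : (((k + 2 : ℕ) : ℝ) + 2) / 2 = ((k : ℝ) + 2) / 2 + 1 := by push_cast; ring
  have h2 : -(((k + 2 : ℕ) : ℝ) + 2) / 2 = -((k : ℝ) + 2) / 2 + -1 := by push_cast; ring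
  rw [h1, h2, Real.Gamma_add_one (by positivity), Real.rpow_add (inv_pos.2 hℏ),
    Real.rpow_neg_one, inv_inv]
  ring

theorem continuous_gaussMonomial (ℏ : ℝ) (k : ℕ) : Continuous (gaussMonomial ℏ k) := by
  unfold gaussMonomial
  have := Complex.continuous_normSq
  fun_prop

theorem integrable_gaussMonomial {ℏ : ℝ} (hℏ : 0 < ℏ) (k : ℕ) :
    Integrable (gaussMonomial ℏ k) := by
  rw [← integrable_norm_iff (continuous_gaussMonomial ℏ k).aestronglyMeasurable]
  by_contra h
  exact (gaussMoment_pos hℏ k).ne' (integral_undef h)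

/-- The real derivative of `gaussMonomial ℏ k` at `ζ` in the direction `w`. -/
noncomputable def gaussMonomialDeriv (ℏ : ℝ) (k : ℕ) (w ζ : ℂ) : ℂ :=
  k * w * gaussMonomial ℏ (k - 1) ζ -
    (2 / ℏ * (ζ.re * w.re + ζ.im * w.im) : ℝ) * gaussMonomial ℏ k ζ

theorem hasDerivAt_gaussMonomial (ℏ : ℝ) (k : ℕ) (w ζ : ℂ) :
    HasDerivAt (fun t : ℝ => gaussMonomial ℏ k (ζ + t • w)) (gaussMonomialDeriv ℏ k w ζ) 0 := by
  have h1 : HasDerivAt (fun t : ℝ => ζ + t • w) w 0 := by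
    simpa using ((hasDerivAt_id (0 : ℝ)).smul_const w).const_add ζ
  have h2 : HasDerivAt (fun t : ℝ => (ζ + t • w) ^ k) (k * ζ ^ (k - 1) * w) 0 := by
    convert! h1.pow k using 1
    simp
  have h3 : HasDerivAt (fun t : ℝ => -Complex.normSq (ζ + t • w) / ℏ)
      (-(2 * (ζ.re * w.re + ζ.im * w.im)) / ℏ) 0 := by
    have hr : HasDerivAt (fun t : ℝ => ζ.re + t * w.re) w.re 0 := by
      simpa using ((hasDerivAt_id (0 : ℝ)).mul_const w.re).const_add ζ.re
    have hi : HasDerivAt (fun t : ℝ => ζ.im + t * w.im) w.im 0 := by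
      simpa using ((hasDerivAt_id (0 : ℝ)).mul_const w.im).const_add ζ.im
    have := (((hr.mul hr).add (hi.mul hi)).neg.div_const ℏ)
    convert! this using 1
    · ext t
      simp [Complex.normSq_apply]
    · simp; ring
  have h4 := h2.mul h3.exp.ofReal_comp
  convert! h4 using 1
  simp only [gaussMonomialDeriv, gaussMonomial, zero_smul, add_zero]
  push_cast
  ring

theorem continuous_gaussMonomialDeriv (ℏ : ℝ) (k : ℕ) (w : ℂ) :
    Continuous (gaussMonomialDeriv ℏ k w) := by
  unfold gaussMonomialDeriv
  have := continuous_gaussMonomial ℏ k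
  have := continuous_gaussMonomial ℏ (k - 1)
  fun_prop

theorem integrable_gaussMonomialDeriv {ℏ : ℝ} (hℏ : 0 < ℏ) (k : ℕ) (w : ℂ) :
    Integrable (gaussMonomialDeriv ℏ k w) := by
  refine ((integrable_gaussMonomial hℏ (k - 1)).const_mul _).sub ?_
  have hc := continuous_gaussMonomial ℏ k
  refine ((integrable_gaussMonomial hℏ (k + 1)).norm.const_mul (2 / ℏ * (2 * ‖w‖))).mono'
    (by fun_prop) (ae_of_all _ fun ζ => ?_)
  have h : ‖gaussMonomial ℏ (k + 1) ζ‖ = ‖ζ‖ * ‖gaussMonomial ℏ k ζ‖ := by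
    rw [← norm_mul, gaussMonomial, gaussMonomial, pow_succ']
    ring_nf
  have h' : |ζ.re * w.re + ζ.im * w.im| ≤ ‖ζ‖ * ‖w‖ + ‖ζ‖ * ‖w‖ := by
    refine (abs_add_le _ _).trans ?_
    rw [abs_mul, abs_mul]
    gcongr <;> first | exact Complex.abs_re_le_norm _ | exact Complex.abs_im_le_norm _
  rw [norm_mul, Complex.norm_real, Real.norm_eq_abs, abs_mul, abs_of_pos (by positivity), h]
  calc _ ≤ 2 / ℏ * (‖ζ‖ * ‖w‖ + ‖ζ‖ * ‖w‖) * ‖gaussMonomial ℏ k ζ‖ := by gcongr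
    _ = _ := by ring

/-- The Cauchy–Riemann operator turns the weight of degree `k` into that of degree `k + 1`. -/
theorem gaussMonomialDeriv_one_add_I_mul (ℏ : ℝ) (k : ℕ) (ζ : ℂ) :
    gaussMonomialDeriv ℏ k 1 ζ + Complex.I * gaussMonomialDeriv ℏ k Complex.I ζ =
      -(2 / ℏ : ℂ) * gaussMonomial ℏ (k + 1) ζ := by
  have h : gaussMonomial ℏ (k + 1) ζ = (ζ.re + ζ.im * Complex.I) * gaussMonomial ℏ k ζ := by
    rw [Complex.re_add_im, gaussMonomial, gaussMonomial, pow_succ']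
    ring
  rw [h]
  simp only [gaussMonomialDeriv, Complex.one_re, Complex.one_im, Complex.I_re, Complex.I_im]
  push_cast
  linear_combination (k * gaussMonomial ℏ (k - 1) ζ) * Complex.I_mul_I

/-- Moments with the first three degrees kept and the other degrees lowered by three. -/
noncomputable def loweredMoment (ℏ : ℝ) (k : ℕ) : ℝ :=
  if k < 3 then gaussMoment ℏ k else gaussMoment ℏ (k - 3)

theorem loweredMoment_nonneg (ℏ : ℝ) (k : ℕ) : 0 ≤ loweredMoment ℏ k := by
  unfold loweredMoment
  split_ifs <;> exact gaussMoment_nonneg _ _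

theorem exists_gaussMoment_sq_le {ℏ : ℝ} (hℏ : 0 < ℏ) :
    ∃ D : ℝ, 0 ≤ D ∧ ∀ k : ℕ,
      (2 / ℏ) ^ k * gaussMoment ℏ k ^ 2 / (k.factorial : ℝ) ≤ D * (k + 1) := by
  set c : ℕ → ℝ := fun k => (2 / ℏ) ^ k * gaussMoment ℏ k ^ 2 / (k.factorial : ℝ) with hc
  have hc0 : ∀ k, 0 ≤ c k := fun k => by positivity
  have hrec : ∀ k, c (k + 2) = (k + 2) / (k + 1) * c k := by
    intro k
    simp only [hc, gaussMoment_add_two hℏ, Nat.factorial_succ, pow_add]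
    push_cast
    field_simp
    ring
  refine ⟨c 0 + c 1, add_nonneg (hc0 0) (hc0 1), fun k => ?_⟩
  change c k ≤ _
  induction k using Nat.twoStepInduction with
  | zero => simpa using hc0 1
  | one => push_cast; nlinarith [hc0 0, hc0 1]
  | more k ih _ =>
    rw [hrec]
    calc _ ≤ ((k : ℝ) + 2) / (k + 1) * ((c 0 + c 1) * (k + 1)) := by gcongr
      _ = (c 0 + c 1) * (k + 2) := by field_simp
      _ ≤ _ := by
        push_cast
        nlinarith [hc0 0, hc0 1]

theorem summable_loweredMoment {ℏ : ℝ} (hℏ : 0 < ℏ) :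
    Summable fun k : ℕ => (2 / ℏ) ^ k * loweredMoment ℏ k ^ 2 / (k.factorial : ℝ) := by
  obtain ⟨D, hD, h⟩ := exists_gaussMoment_sq_le hℏ
  rw [← summable_nat_add_iff 3]
  have hs : Summable fun k : ℕ => (2 / ℏ) ^ 3 * D * (1 / ((k + 1 : ℕ) : ℝ) ^ 2) :=
    (((summable_nat_add_iff 1).2 (Real.summable_one_div_nat_pow.2 one_lt_two))).mul_left _
  refine hs.of_nonneg_of_le (fun k => by positivity) fun k => ?_
  have hk : loweredMoment ℏ (k + 3) = gaussMoment ℏ k := by simp [loweredMoment]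
  rw [hk]
  calc _ = (2 / ℏ) ^ 3 * ((2 / ℏ) ^ k * gaussMoment ℏ k ^ 2 / (k.factorial : ℝ)) /
        ((k + 1) * (k + 2) * (k + 3)) := by
        simp only [Nat.factorial_succ, pow_add]
        push_cast
        field_simp
        ring
    _ ≤ (2 / ℏ) ^ 3 * (D * (k + 1)) / ((k + 1) * (k + 2) * (k + 3)) := by
        gcongr
        exact h k
    _ = (2 / ℏ) ^ 3 * D * (1 / ((k + 2) * (k + 3))) := by field_simp
    _ ≤ _ := by
        push_cast
        gcongr
        nlinarith [k.cast_nonneg (α := ℝ)]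

theorem summable_prod_apply {ι : Type*} [Fintype ι] {h : ℕ → ℝ}
    (h0 : ∀ k, 0 ≤ h k) (hs : Summable h) :
    Summable fun K : ι → ℕ => ∏ j, h (K j) := by
  classical
  refine summable_of_sum_le (c := ∏ _j : ι, ∑' k, h k)
    (fun K => Finset.prod_nonneg fun j _ => h0 _) fun s => ?_
  calc _ ≤ ∑ K ∈ Fintype.piFinset fun j => s.image fun K => K j, ∏ j, h (K j) := by
        refine Finset.sum_le_sum_of_subset_of_nonneg (fun K hK => ?_)
          fun K _ _ => Finset.prod_nonneg fun j _ => h0 _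
        exact Fintype.mem_piFinset.2 fun j => Finset.mem_image_of_mem _ hK
    _ = ∏ j, ∑ k ∈ s.image fun K => K j, h k := by rw [Finset.prod_univ_sum]
    _ ≤ _ := Finset.prod_le_prod (fun j _ => Finset.sum_nonneg fun k _ => h0 k)
        fun j _ => hs.sum_le_tsum _ fun k _ => h0 k

section IntegrationByParts

variable {ι E : Type*} [Fintype ι] [NormedAddCommGroup E] [NormedSpace ℂ E]

theorem integrable_prod_smul {h : ι → ℂ → ℂ} (hh : ∀ i, Integrable (h i)) {F : (ι → ℂ) → E}
    (hF : Continuous F) {C : ℝ} (hC : ∀ z, ‖F z‖ ≤ C) :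
    Integrable fun z : ι → ℂ => (∏ i, h i (z i)) • F z :=
  (Integrable.fintype_prod hh).smul_bdd C hF.aestronglyMeasurable (ae_of_all _ hC)

theorem norm_integral_prod_smul_le {h : ι → ℂ → ℂ} (hh : ∀ i, Integrable (h i))
    {F : (ι → ℂ) → E} {C : ℝ} (hC : ∀ z, ‖F z‖ ≤ C) :
    ‖∫ z : ι → ℂ, (∏ i, h i (z i)) • F z‖ ≤ C * ∏ i, ∫ ζ, ‖h i ζ‖ := by
  rw [← integral_fintype_prod_volume_eq_prod (fun i ζ => ‖h i ζ‖), ← integral_const_mul]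
  refine norm_integral_le_of_norm_le
    ((Integrable.fintype_prod fun i => (hh i).norm).const_mul C) (ae_of_all _ fun z => ?_)
  rw [norm_smul, norm_prod, mul_comm]
  gcongr
  exact hC z

variable [DecidableEq ι]

theorem prod_update_apply_eq (h : ι → ℂ → ℂ) (j : ι) (ψ : ℂ → ℂ) (z : ι → ℂ) :
    ∏ i, Function.update h j ψ i (z i) = ψ (z j) * ∏ i ∈ Finset.univ.erase j, h i (z i) := by
  rw [← Finset.mul_prod_erase _ _ (Finset.mem_univ j), Function.update_self]
  congr 1
  refine Finset.prod_congr rfl fun i hi => ?_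
  rw [Function.update_of_ne (Finset.ne_of_mem_erase hi)]

theorem hasLineDerivAt_prod_single {h : ι → ℂ → ℂ} {j : ι} {w : ℂ} {ψ : ℂ → ℂ} {z : ι → ℂ}
    (hψ : HasDerivAt (fun t : ℝ => h j (z j + t • w)) (ψ (z j)) 0) :
    HasLineDerivAt ℝ (fun z : ι → ℂ => ∏ i, h i (z i))
      (∏ i, Function.update h j ψ i (z i)) z (Pi.single j w) := by
  rw [prod_update_apply_eq, HasLineDerivAt]
  convert! hψ.mul_const (∏ i ∈ Finset.univ.erase j, h i (z i)) using 1
  ext t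
  rw [← Finset.mul_prod_erase _ _ (Finset.mem_univ j)]
  congr 1
  · simp
  · refine Finset.prod_congr rfl fun i hi => ?_
    simp [Finset.ne_of_mem_erase hi]

/-- Integration by parts in the direction `w` of the `j`-th coordinate against a weight which is
a product of one-variable functions. -/
theorem integral_prod_smul_lineDeriv {h : ι → ℂ → ℂ} (hh : ∀ i, Integrable (h i)) {j : ι} {w : ℂ}
    {ψ : ℂ → ℂ} (hψi : Integrable ψ)
    (hψ : ∀ ζ, HasDerivAt (fun t : ℝ => h j (ζ + t • w)) (ψ ζ) 0)
    {F F' : (ι → ℂ) → E} (hF : Continuous F) (hF' : Continuous F') {C C' : ℝ}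
    (hC : ∀ z, ‖F z‖ ≤ C) (hC' : ∀ z, ‖F' z‖ ≤ C')
    (hFF' : ∀ z, HasLineDerivAt ℝ F (F' z) z (Pi.single j w)) :
    ∫ z : ι → ℂ, (∏ i, h i (z i)) • F' z =
      -∫ z : ι → ℂ, (∏ i, Function.update h j ψ i (z i)) • F z := by
  have hu : ∀ i, Integrable (Function.update h j ψ i) := by
    intro i
    rcases eq_or_ne i j with rfl | hij
    · simpa using hψi
    · simpa [hij] using hh i
  exact integral_bilinear_hasLineDerivAt_right_eq_neg_left_of_integrable
    (B := ContinuousLinearMap.lsmul ℝ ℂ) (v := Pi.single j w)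
    (integrable_prod_smul hu hF hC) (integrable_prod_smul hh hF' hC')
    (integrable_prod_smul hh hF hC)
    (fun z _ => hasLineDerivAt_prod_single (hψ (z j))) fun z _ => hFF' z

end IntegrationByParts

section Orbit

variable {V A : Type*} [NormedAddCommGroup V] [NormedSpace ℝ V] [NonUnitalCStarAlgebra A]
  {α : V → (A ≃⋆ₐ[ℂ] A)}

/-- A *-automorphism of a C*-algebra as a real continuous linear map. -/
noncomputable def starAlgEquivCLM (φ : A ≃⋆ₐ[ℂ] A) : A →L[ℝ] A :=
  LinearMap.mkContinuous
    { toFun := φ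
      map_add' := map_add φ
      map_smul' := fun r a => map_smul φ (r : ℂ) a } 1
    fun a => by simpa using (StarAlgEquiv.norm_map φ a).le

theorem starAlgEquivCLM_apply (φ : A ≃⋆ₐ[ℂ] A) (a : A) : starAlgEquivCLM φ a = φ a := rfl

/-- The infinitesimal action `d/dt α_{t w}(a)` at `t = 0`. -/
noncomputable def orbitDeriv (α : V → (A ≃⋆ₐ[ℂ] A)) (a : A) (w : V) : A :=
  fderiv ℝ (fun u => α u a) 0 w

theorem fderiv_orbit (hhom : ∀ u v : V, ∀ a : A, α (u + v) a = α u (α v a)) {a : A}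
    (ha : ContDiff ℝ (⊤ : ℕ∞) fun u => α u a) (u w : V) :
    fderiv ℝ (fun u => α u a) u w = α u (orbitDeriv α a w) := by
  have hd : Differentiable ℝ fun u => α u a := ha.differentiable (by simp)
  have h1 : (fun v => α (u + v) a) = fun v => starAlgEquivCLM (α u) (α v a) := by
    ext v
    rw [hhom, starAlgEquivCLM_apply]
  have h2 := fderiv_comp_add_left (𝕜 := ℝ) (f := fun v => α v a) (x := 0) u
  rw [h1, add_zero] at h2
  have h3 : HasFDerivAt (fun v => starAlgEquivCLM (α u) (α v a))
      ((starAlgEquivCLM (α u)).comp (fderiv ℝ (fun v => α v a) 0)) 0 :=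
    (starAlgEquivCLM (α u)).hasFDerivAt.comp (0 : V) (hd 0).hasFDerivAt
  rw [← h2, h3.fderiv]
  rfl

theorem hasLineDerivAt_orbit (hhom : ∀ u v : V, ∀ a : A, α (u + v) a = α u (α v a)) {a : A}
    (ha : ContDiff ℝ (⊤ : ℕ∞) fun u => α u a) (u w : V) :
    HasLineDerivAt ℝ (fun u => α u a) (α u (orbitDeriv α a w)) u w := by
  rw [← fderiv_orbit hhom ha]
  exact (ha.differentiable (by simp) u).hasFDerivAt.hasLineDerivAt w

theorem contDiff_orbit_orbitDeriv (hhom : ∀ u v : V, ∀ a : A, α (u + v) a = α u (α v a)) {a : A}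
    (ha : ContDiff ℝ (⊤ : ℕ∞) fun u => α u a) (w : V) :
    ContDiff ℝ (⊤ : ℕ∞) fun u => α u (orbitDeriv α a w) := by
  simp_rw [← fderiv_orbit hhom ha]
  exact (ha.fderiv_right (by simp)).clm_apply contDiff_const

/-- The Cauchy–Riemann operator `δ_j = d_{f_j} + i d_{Jf_j}` on smooth vectors. -/
noncomputable def orbitDbar {ι : Type*} (f Jf : ι → V) (α : V → (A ≃⋆ₐ[ℂ] A)) (j : ι) (a : A) : A :=
  orbitDeriv α a (f j) + Complex.I • orbitDeriv α a (Jf j)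

theorem contDiff_orbit_orbitDbar {ι : Type*} {f Jf : ι → V}
    (hhom : ∀ u v : V, ∀ a : A, α (u + v) a = α u (α v a)) (j : ι) {a : A}
    (ha : ContDiff ℝ (⊤ : ℕ∞) fun u => α u a) :
    ContDiff ℝ (⊤ : ℕ∞) fun u => α u (orbitDbar f Jf α j a) := by
  simp_rw [orbitDbar, map_add, map_smul]
  exact (contDiff_orbit_orbitDeriv hhom ha _).add
    ((contDiff_orbit_orbitDeriv hhom ha _).const_smul Complex.I)

/-- The point `Σ_j (Re z_j) f_j + (Im z_j) Jf_j` with complex coordinates `z`. -/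
noncomputable def complexCoordPoint {ι : Type*} [Fintype ι] (f Jf : ι → V) (z : ι → ℂ) : V :=
  ∑ j, ((z j).re • f j + (z j).im • Jf j)

section ComplexCoordPoint

variable {ι : Type*} [Fintype ι] (f Jf : ι → V)

theorem continuous_complexCoordPoint : Continuous (complexCoordPoint f Jf) := by
  unfold complexCoordPoint
  fun_prop

theorem complexCoordPoint_add_smul_single [DecidableEq ι] (z : ι → ℂ) (t : ℝ) (j : ι) (w : ℂ) :
    complexCoordPoint f Jf (z + t • (Pi.single j w : ι → ℂ)) =
      complexCoordPoint f Jf z + t • (w.re • f j + w.im • Jf j) := by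
  have h : ∀ i, ((Pi.single j w : ι → ℂ) i).re • f i + ((Pi.single j w : ι → ℂ) i).im • Jf i =
      if i = j then w.re • f j + w.im • Jf j else 0 := by
    intro i
    rcases eq_or_ne i j with rfl | hij
    · simp
    · simp [hij]
  have h' : w.re • f j + w.im • Jf j = ∑ i, (((Pi.single j w : ι → ℂ) i).re • f i +
      ((Pi.single j w : ι → ℂ) i).im • Jf i) := by
    simp [h]
  rw [h', complexCoordPoint, complexCoordPoint, Finset.smul_sum, ← Finset.sum_add_distrib]
  refine Finset.sum_congr rfl fun i _ => ?_
  simp only [Pi.add_apply, Pi.smul_apply, Complex.add_re, Complex.add_im, Complex.smul_re,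
    Complex.smul_im, smul_eq_mul]
  module

variable {f Jf}

theorem hasLineDerivAt_orbit_complexCoordPoint [DecidableEq ι]
    (hhom : ∀ u v : V, ∀ a : A, α (u + v) a = α u (α v a)) {a : A}
    (ha : ContDiff ℝ (⊤ : ℕ∞) fun u => α u a) (j : ι) (w : ℂ) (z : ι → ℂ) :
    HasLineDerivAt ℝ (fun z => α (complexCoordPoint f Jf z) a)
      (α (complexCoordPoint f Jf z) (orbitDeriv α a (w.re • f j + w.im • Jf j)))
      z (Pi.single j w) := by
  have := hasLineDerivAt_orbit hhom ha (complexCoordPoint f Jf z) (w.re • f j + w.im • Jf j)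
  rw [HasLineDerivAt] at this ⊢
  simpa only [complexCoordPoint_add_smul_single] using this

/-- The integral of an orbit against a product of Gaussian monomials. -/
noncomputable def gaussCoeff (α : V → (A ≃⋆ₐ[ℂ] A)) (f Jf : ι → V) (ℏ : ℝ) (a : A)
    (K : ι → ℕ) : A :=
  ∫ z : ι → ℂ, (∏ j, gaussMonomial ℏ (K j) (z j)) • α (complexCoordPoint f Jf z) a

theorem norm_gaussCoeff_le {ℏ : ℝ} (hℏ : 0 < ℏ) (a : A) (K : ι → ℕ) :
    ‖gaussCoeff α f Jf ℏ a K‖ ≤ ‖a‖ * ∏ j, gaussMoment ℏ (K j) :=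
  norm_integral_prod_smul_le (fun j => integrable_gaussMonomial hℏ (K j))
    fun _ => (StarAlgEquiv.norm_map _ a).le

theorem gaussCoeff_add_single [DecidableEq ι]
    (hhom : ∀ u v : V, ∀ a : A, α (u + v) a = α u (α v a)) {ℏ : ℝ} (hℏ : 0 < ℏ) {a : A}
    (ha : ContDiff ℝ (⊤ : ℕ∞) fun u => α u a) (j : ι) (K : ι → ℕ) :
    gaussCoeff α f Jf ℏ a (K + Pi.single j 1) =
      (ℏ / 2 : ℂ) • gaussCoeff α f Jf ℏ (orbitDbar f Jf α j a) K := by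
  have hL := continuous_complexCoordPoint f Jf
  have hint := fun i => integrable_gaussMonomial hℏ (K i)
  have hcont : ∀ {b : A}, ContDiff ℝ (⊤ : ℕ∞) (fun u => α u b) →
      Continuous fun z => α (complexCoordPoint f Jf z) b := fun hb => hb.continuous.comp hL
  have hnorm : ∀ (b : A) (z : ι → ℂ), ‖α (complexCoordPoint f Jf z) b‖ ≤ ‖b‖ :=
    fun b z => (StarAlgEquiv.norm_map _ b).le
  have hparts : ∀ w : ℂ, ∫ z : ι → ℂ, (∏ i, gaussMonomial ℏ (K i) (z i)) •
        α (complexCoordPoint f Jf z) (orbitDeriv α a (w.re • f j + w.im • Jf j)) =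
      -∫ z : ι → ℂ, (∏ i, Function.update (fun i => gaussMonomial ℏ (K i)) j
        (gaussMonomialDeriv ℏ (K j) w) i (z i)) • α (complexCoordPoint f Jf z) a := fun w =>
    integral_prod_smul_lineDeriv hint (integrable_gaussMonomialDeriv hℏ (K j) w)
      (hasDerivAt_gaussMonomial ℏ (K j) w) (hcont ha)
      (hcont (contDiff_orbit_orbitDeriv hhom ha _)) (hnorm _) (hnorm _)
      (hasLineDerivAt_orbit_complexCoordPoint hhom ha j w)
  have hi : ∀ w : ℂ, Integrable fun z : ι → ℂ => (∏ i, gaussMonomial ℏ (K i) (z i)) •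
      α (complexCoordPoint f Jf z) (orbitDeriv α a (w.re • f j + w.im • Jf j)) := fun w =>
    integrable_prod_smul hint (hcont (contDiff_orbit_orbitDeriv hhom ha _)) (hnorm _)
  have hi' : ∀ w : ℂ, Integrable fun z : ι → ℂ =>
      (∏ i, Function.update (fun i => gaussMonomial ℏ (K i)) j
        (gaussMonomialDeriv ℏ (K j) w) i (z i)) • α (complexCoordPoint f Jf z) a := fun w =>
    integrable_prod_smul (fun i => by
      rcases eq_or_ne i j with rfl | hij
      · simpa using integrable_gaussMonomialDeriv hℏ (K i) w
      · simpa [hij] using hint i) (hcont ha) (hnorm _)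
  have key : gaussCoeff α f Jf ℏ (orbitDbar f Jf α j a) K =
      (2 / ℏ : ℂ) • gaussCoeff α f Jf ℏ a (K + Pi.single j 1) := by
    calc _ = (∫ z : ι → ℂ, (∏ i, gaussMonomial ℏ (K i) (z i)) • α (complexCoordPoint f Jf z)
            (orbitDeriv α a ((1 : ℂ).re • f j + (1 : ℂ).im • Jf j))) +
          Complex.I • ∫ z : ι → ℂ, (∏ i, gaussMonomial ℏ (K i) (z i)) •
            α (complexCoordPoint f Jf z)
              (orbitDeriv α a (Complex.I.re • f j + Complex.I.im • Jf j)) := by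
          rw [← integral_smul, ← integral_add (hi 1) ((hi Complex.I).fun_smul Complex.I), gaussCoeff]
          refine integral_congr_ae (ae_of_all _ fun z => ?_)
          simp only [orbitDbar, map_add, map_smul, smul_add, Complex.one_re, Complex.one_im,
            Complex.I_re, Complex.I_im, one_smul, zero_smul, add_zero, zero_add]
          rw [smul_comm Complex.I]
      _ = _ := by
          rw [hparts, hparts, smul_neg, ← neg_add, ← integral_smul,
            ← integral_add (hi' 1) ((hi' Complex.I).fun_smul Complex.I), gaussCoeff, ← integral_smul,
            ← integral_neg]
          refine integral_congr_ae (ae_of_all _ fun z => ?_)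
          have hK : ∏ i, gaussMonomial ℏ ((K + Pi.single j 1 : ι → ℕ) i) (z i) =
              gaussMonomial ℏ (K j + 1) (z j) *
                ∏ i ∈ Finset.univ.erase j, gaussMonomial ℏ (K i) (z i) := by
            rw [← prod_update_apply_eq]
            refine Finset.prod_congr rfl fun i _ => ?_
            rcases eq_or_ne i j with rfl | hij
            · simp
            · simp [hij]
          simp only [prod_update_apply_eq, hK, smul_smul]
          rw [← add_smul, ← neg_smul]
          congr 1
          linear_combination (-∏ i ∈ Finset.univ.erase j, gaussMonomial ℏ (K i) (z i)) *
            gaussMonomialDeriv_one_add_I_mul ℏ (K j) (z j)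
  have hne : (ℏ : ℂ) ≠ 0 := by exact_mod_cast hℏ.ne'
  rw [key, smul_smul]
  field_simp
  simp

theorem gaussCoeff_add_single_three [DecidableEq ι]
    (hhom : ∀ u v : V, ∀ a : A, α (u + v) a = α u (α v a)) {ℏ : ℝ} (hℏ : 0 < ℏ) {a : A}
    (ha : ContDiff ℝ (⊤ : ℕ∞) fun u => α u a) (j : ι) (K : ι → ℕ) :
    gaussCoeff α f Jf ℏ a (K + Pi.single j 3) = (ℏ / 2 : ℂ) ^ 3 •
      gaussCoeff α f Jf ℏ (orbitDbar f Jf α j (orbitDbar f Jf α j (orbitDbar f Jf α j a))) K := by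
  have h3 : K + Pi.single j 3 = K + Pi.single j 1 + Pi.single j 1 + Pi.single j 1 := by
    rw [add_assoc, add_assoc, ← Pi.single_add, ← Pi.single_add,
      one_add_one_eq_two, add_comm 1 2, two_add_one_eq_three]
  have h1 := contDiff_orbit_orbitDbar (f := f) (Jf := Jf) hhom j ha
  rw [h3, gaussCoeff_add_single hhom hℏ ha, gaussCoeff_add_single hhom hℏ h1,
    gaussCoeff_add_single hhom hℏ (contDiff_orbit_orbitDbar hhom j h1), smul_smul, smul_smul]
  ring_nf

/-- For a smooth vector the moments bounding the Gaussian coefficients can be lowered in any set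
of coordinates. -/
theorem exists_norm_gaussCoeff_le [DecidableEq ι]
    (hhom : ∀ u v : V, ∀ a : A, α (u + v) a = α u (α v a)) {ℏ : ℝ} (hℏ : 0 < ℏ)
    (s : Finset ι) :
    ∀ a : A, ContDiff ℝ (⊤ : ℕ∞) (fun u => α u a) → ∃ C : ℝ, 0 ≤ C ∧ ∀ K : ι → ℕ,
      ‖gaussCoeff α f Jf ℏ a K‖ ≤
        C * ∏ j, if j ∈ s then loweredMoment ℏ (K j) else gaussMoment ℏ (K j) := by
  have h0 : ∀ (s : Finset ι) (K : ι → ℕ),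
      0 ≤ ∏ j, if j ∈ s then loweredMoment ℏ (K j) else gaussMoment ℏ (K j) := fun s K =>
    Finset.prod_nonneg fun j _ => by
      split_ifs
      exacts [loweredMoment_nonneg _ _, gaussMoment_nonneg _ _]
  induction s using Finset.induction_on with
  | empty => exact fun a _ => ⟨‖a‖, norm_nonneg a, fun K => by
      simpa using norm_gaussCoeff_le hℏ a K⟩
  | insert i s his ih =>
    intro a ha
    obtain ⟨C, hC, h⟩ := ih a ha
    obtain ⟨C', hC', h'⟩ := ih _ (contDiff_orbit_orbitDbar (f := f) (Jf := Jf) hhom i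
      (contDiff_orbit_orbitDbar (f := f) (Jf := Jf) hhom i
        (contDiff_orbit_orbitDbar (f := f) (Jf := Jf) hhom i ha)))
    refine ⟨max C ((ℏ / 2) ^ 3 * C'), le_max_of_le_left hC, fun K => ?_⟩
    rcases lt_or_ge (K i) 3 with hK | hK
    · refine (h K).trans ?_
      have : ∏ j, (if j ∈ s then loweredMoment ℏ (K j) else gaussMoment ℏ (K j)) =
          ∏ j, if j ∈ insert i s then loweredMoment ℏ (K j) else gaussMoment ℏ (K j) := by
        refine Finset.prod_congr rfl fun j _ => ?_
        rcases eq_or_ne j i with rfl | hji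
        · simp [his, loweredMoment, hK]
        · simp [hji]
      rw [this]
      exact mul_le_mul_of_nonneg_right (le_max_left _ _) (h0 _ K)
    · obtain ⟨K, rfl⟩ : ∃ K' : ι → ℕ, K = K' + Pi.single i 3 :=
        ⟨K - Pi.single i 3, (tsub_add_cancel_of_le fun j => by
          rcases eq_or_ne j i with rfl | hji
          · simpa using hK
          · simp [hji]).symm⟩
      have hn : ‖(ℏ / 2 : ℂ) ^ 3‖ = (ℏ / 2) ^ 3 := by
        rw [norm_pow, norm_div, Complex.norm_real, Real.norm_of_nonneg hℏ.le]
        simp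
      rw [gaussCoeff_add_single_three hhom hℏ ha, norm_smul, hn]
      have : ∏ j, (if j ∈ s then loweredMoment ℏ (K j) else gaussMoment ℏ (K j)) =
          ∏ j, if j ∈ insert i s then loweredMoment ℏ ((K + Pi.single i 3 : ι → ℕ) j)
            else gaussMoment ℏ ((K + Pi.single i 3 : ι → ℕ) j) := by
        refine Finset.prod_congr rfl fun j _ => ?_
        rcases eq_or_ne j i with rfl | hji
        · simp [his, loweredMoment]
        · simp [hji]
      calc _ ≤ (ℏ / 2) ^ 3 * (C' * ∏ j, if j ∈ s then loweredMoment ℏ (K j)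
            else gaussMoment ℏ (K j)) := by
            gcongr
            exact h' K
        _ = (ℏ / 2) ^ 3 * C' * ∏ j, (if j ∈ s then loweredMoment ℏ (K j)
            else gaussMoment ℏ (K j)) := by ring
        _ ≤ _ := by
            rw [this]
            exact mul_le_mul_of_nonneg_right (le_max_right _ _) (h0 _ _)

end ComplexCoordPoint

end Orbit

theorem wickCoeff_eq_gaussCoeff {n : ℕ} {A : Type*} [NonUnitalCStarAlgebra A]
    (α : (Fin (2*n) → ℝ) → (A ≃⋆ₐ[ℂ] A)) (f Jf : Fin n → (Fin (2*n) → ℝ))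
    (ℏ : ℝ) (a : A) (K : Fin n → ℕ) :
    wickCoeff α f Jf ℏ a K = gaussCoeff α f Jf ℏ a K := by
  rw [wickCoeff, gaussCoeff]
  congr 1
  ext z
  simp only [gaussMonomial, Finset.prod_mul_distrib, complexCoordPoint]
  rw [← Complex.ofReal_prod, ← Real.exp_sum, ← Finset.sum_div, Finset.sum_neg_distrib]

theorem summable_norm_wickTerm {n : ℕ} {A : Type*} [NonUnitalCStarAlgebra A]
    {α : (Fin (2*n) → ℝ) → (A ≃⋆ₐ[ℂ] A)} (hhom : ∀ u v, ∀ a : A, α (u + v) a = α u (α v a))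
    (f Jf : Fin n → (Fin (2*n) → ℝ)) {ℏ : ℝ} (hℏ : 0 < ℏ) {a : A}
    (ha : ContDiff ℝ (⊤ : ℕ∞) fun u => α u a) :
    Summable fun K : Fin n → ℕ => ‖wickTerm α f Jf ℏ a K‖ := by
  obtain ⟨C, hC, h⟩ := exists_norm_gaussCoeff_le (f := f) (Jf := Jf) hhom hℏ Finset.univ a ha
  simp only [Finset.mem_univ, if_true] at h
  have hs := (summable_prod_apply (ι := Fin n) (fun k => by positivity)
    (summable_loweredMoment hℏ)).mul_left (((Real.pi * ℏ) ^ n)⁻¹ * C ^ 2)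
  refine hs.of_nonneg_of_le (fun K => norm_nonneg _) fun K => ?_
  rw [wickTerm, norm_smul, CStarRing.norm_star_mul_self, wickCoeff_eq_gaussCoeff,
    Real.norm_of_nonneg (by positivity)]
  calc _ ≤ ((Real.pi * ℏ) ^ n)⁻¹ * ((∏ j, (K j).factorial : ℕ) : ℝ)⁻¹ * (2 / ℏ) ^ (∑ j, K j) *
        ((C * ∏ j, loweredMoment ℏ (K j)) * (C * ∏ j, loweredMoment ℏ (K j))) := by
        have := (norm_nonneg _).trans (h K)
        gcongr <;> exact h K
    _ = _ := by
        rw [Finset.prod_div_distrib, Finset.prod_mul_distrib, Finset.prod_pow,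
          Finset.prod_pow_eq_pow_sum]
        push_cast
        ring

theorem exists_tsum_eq_star_mul_self {ι A : Type*} [NonUnitalCStarAlgebra A] {c : ι → ℝ}
    (hc : ∀ i, 0 ≤ c i) (x : ι → A) :
    ∃ b : A, ∑' i, c i • (star (x i) * x i) = star b * b := by
  let _ := CStarAlgebra.spectralOrder A
  have _ := CStarAlgebra.spectralOrderedRing A
  refine CStarAlgebra.nonneg_iff_eq_star_mul_self.1 (tsum_nonneg fun i => ?_)
  have h : c i • (star (x i) * x i) = star (√(c i) • x i) * (√(c i) • x i) := by
    rw [star_smul, smul_mul_smul_comm, star_trivial (√(c i)), Real.mul_self_sqrt (hc i)]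
  rw [h]
  exact star_mul_self_nonneg _

theorem wick_series_positive {n : ℕ} {A : Type*} [NonUnitalCStarAlgebra A]
    -- `α` is an action of `(ℝ^{2n}, +)` by *-automorphisms ...
    (α : (Fin (2*n) → ℝ) → (A ≃⋆ₐ[ℂ] A))
    (hhom : ∀ u v : Fin (2*n) → ℝ, ∀ a : A, α (u + v) a = α u (α v a))
    -- ... which is strongly continuous:
    (hcont : ∀ a : A, Continuous fun u => α u a)
    -- `J` is a linear complex structure on `ℝ^{2n}` ...
    (J : (Fin (2*n) → ℝ) →ₗ[ℝ] (Fin (2*n) → ℝ))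
    (hJ : ∀ u, J (J u) = -u)
    -- ... compatible with the standard symplectic form `θ`, i.e. `g(u,v) = θ(u, Jv)` is a
    -- symmetric positive-definite inner product:
    (g : (Fin (2*n) → ℝ) → (Fin (2*n) → ℝ) → ℝ)
    (hg : ∀ u v, g u v = stdSymp n u (J v))
    (hgsymm : ∀ u v, g u v = g v u)
    (hgpos : ∀ u, u ≠ 0 → 0 < g u u)
    -- `f 1, …, f n, J (f 1), …, J (f n)` is a `g`-orthonormal basis of `ℝ^{2n}`:
    (f : Fin n → (Fin (2*n) → ℝ))
    (horth₁ : ∀ i j, g (f i) (f j) = if i = j then 1 else 0)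
    (horth₂ : ∀ i j, g (J (f i)) (J (f j)) = if i = j then 1 else 0)
    (horth₃ : ∀ i j, g (f i) (J (f j)) = 0) :
    ∀ ℏ : ℝ, 0 < ℏ → ∀ a : A, ContDiff ℝ (⊤ : ℕ∞) (fun u : Fin (2*n) → ℝ => α u a) →
      -- the Wick-type series converges absolutely in norm ...
      Summable (fun K : Fin n → ℕ => ‖wickTerm α f (fun j => J (f j)) ℏ a K‖) ∧
      -- ... and its sum is a positive element of `A`:
      ∃ b : A, (∑' K : Fin n → ℕ, wickTerm α f (fun j => J (f j)) ℏ a K) = star b * b := by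
  intro ℏ hℏ a ha
  exact ⟨summable_norm_wickTerm hhom f _ hℏ ha,
    exists_tsum_eq_star_mul_self (fun K => by positivity) _⟩
end
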